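/- Let $h$ be a Griffiths semi-negative singular Hermitian metric on a trivial bundle over a polydisk. Then $\partial(\det h)\in L^2_{loc}$, the forms $\partial(\det h_\nu)$ are in $L^2_{loc}$ uniformly in $\nu$ for any approximating decreasing sequence $h_\nu$ of smooth Griffiths semi-negative metrics, and $\partial(\det h_\nu)$ converges weakly to $\partial(\det h)$ in $L^2_{loc}$. -/

import Mathlib

open MeasureTheory Complex Metric Matrix Filter Topology
open scoped ComplexOrder ENNReal NNReal

noncomputable section

abbrev Cn (n : ℕ) := Fin n → ℂ

def basisV {n : ℕ} (j : Fin n) : Cn n := fun k => if k = j then 1 else 0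

/-- Wirtinger derivative `∂/∂z_j` (junk value where `f` is not differentiable). -/
def wder {n : ℕ} (j : Fin n) (f : Cn n → ℂ) (z : Cn n) : ℂ :=
  (1 / 2 : ℂ) * (fderiv ℝ f z (basisV j) - Complex.I * fderiv ℝ f z (Complex.I • basisV j))

/-- Wirtinger derivative `∂/∂z̄_j`. -/
def wbar {n : ℕ} (j : Fin n) (f : Cn n → ℂ) (z : Cn n) : ℂ :=
  (1 / 2 : ℂ) * (fderiv ℝ f z (basisV j) + Complex.I * fderiv ℝ f z (Complex.I • basisV j))

/-- Plurisubharmonicity (extended-real valued) on `U`: upper semicontinuity together with the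
sub-mean value property on complex lines, expressed via comparison with boundary values of
harmonic functions (real parts of holomorphic functions) on discs. -/
def PshOn {n : ℕ} (f : Cn n → EReal) (U : Set (Cn n)) : Prop :=
  UpperSemicontinuousOn f U ∧
  ∀ z ∈ U, ∀ v : Cn n, ∀ r : ℝ, 0 < r →
    (∀ w : ℂ, ‖w‖ ≤ r → z + w • v ∈ U) →
    ∀ F : ℂ → ℂ, ContinuousOn F (closedBall 0 r) → DifferentiableOn ℂ F (ball 0 r) →
      (∀ w : ℂ, ‖w‖ = r → f (z + w • v) ≤ ((F w).re : EReal)) →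
      f z ≤ ((F 0).re : EReal)

def PshOnR {n : ℕ} (f : Cn n → ℝ) (U : Set (Cn n)) : Prop :=
  PshOn (fun z => (f z : EReal)) U

/-- `|v|²_h` for a Hermitian matrix `h`. -/
def sqNorm {r : ℕ} (h : Matrix (Fin r) (Fin r) ℂ) (v : Fin r → ℂ) : ℝ :=
  (star v ⬝ᵥ h.mulVec v).re

/-- Chern connection form `θ_j = h⁻¹ ∂_j h`. -/
def connForm {n r : ℕ} (h : Cn n → Matrix (Fin r) (Fin r) ℂ) (j : Fin n) (z : Cn n) :
    Matrix (Fin r) (Fin r) ℂ :=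
  (h z)⁻¹ * (Matrix.of fun a b => wder j (fun w => h w a b) z)

/-- Chern curvature coefficients `Θ_{j k̄} = ∂̄_k (h⁻¹ ∂_j h)`. -/
def curvMat {n r : ℕ} (h : Cn n → Matrix (Fin r) (Fin r) ℂ) (j k : Fin n) (z : Cn n) :
    Matrix (Fin r) (Fin r) ℂ :=
  Matrix.of fun a b => wbar k (fun w => connForm h j w a b) z

/-- The Hermitian form `Θ_{E,h}(ξ ⊗ v, ξ ⊗ v) = (√-1 Θ(ξ, ξ̄) v, v)_h`. -/
def griffithsForm {n r : ℕ} (h : Cn n → Matrix (Fin r) (Fin r) ℂ) (z : Cn n)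
    (ξ : Fin n → ℂ) (v : Fin r → ℂ) : ℝ :=
  - (∑ j, ∑ k, ξ j * (starRingEnd ℂ) (ξ k) *
      (star v ⬝ᵥ ((h z) * curvMat h j k z).mulVec v)).re

def SmoothMetricOn {n r : ℕ} (U : Set (Cn n)) (h : Cn n → Matrix (Fin r) (Fin r) ℂ) : Prop :=
  (∀ a b, ContDiffOn ℝ (⊤ : ℕ∞) (fun z => h z a b) U) ∧ ∀ z ∈ U, (h z).PosDef

def HolSection {n r : ℕ} (V : Set (Cn n)) (u : Cn n → Fin r → ℂ) : Prop :=
  ∀ a, DifferentiableOn ℂ (fun z => u z a) V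

/-- Griffiths semi-negativity: `|u|²_h` is psh for every local holomorphic section. -/
def GriffithsSemiNegOn {n r : ℕ} (U : Set (Cn n)) (h : Cn n → Matrix (Fin r) (Fin r) ℂ) : Prop :=
  ∀ V, IsOpen V → V ⊆ U → ∀ u, HolSection V u →
    PshOnR (fun z => sqNorm (h z) (u z)) V

/-- The dual metric `h⋆` on the dual bundle. -/
def dualMetric {n r : ℕ} (h : Cn n → Matrix (Fin r) (Fin r) ℂ) (z : Cn n) :
    Matrix (Fin r) (Fin r) ℂ := ((h z)⁻¹)ᵀ

def GriffithsSemiPosOn {n r : ℕ} (U : Set (Cn n)) (h : Cn n → Matrix (Fin r) (Fin r) ℂ) : Prop :=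
  GriffithsSemiNegOn U (dualMetric h)

def IsSingularMetricOn {n r : ℕ} (U : Set (Cn n)) (h : Cn n → Matrix (Fin r) (Fin r) ℂ) : Prop :=
  (∀ a b, Measurable fun z => h z a b) ∧ (∀ z ∈ U, (h z).PosSemidef) ∧
    (∀ᵐ z, z ∈ U → (h z).det ≠ 0)

def Polydisk {n : ℕ} (R : Fin n → ℝ) : Set (Cn n) := {z | ∀ j, ‖z j‖ < R j}

/-- `F = ∂_m f` in the sense of distributions on `U`. -/
def IsWeakWirtDeriv {n : ℕ} (U : Set (Cn n)) (m : Fin n) (f F : Cn n → ℂ) : Prop :=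
  ∀ φ : Cn n → ℂ, ContDiff ℝ (⊤ : ℕ∞) φ → HasCompactSupport φ → tsupport φ ⊆ U →
    ∫ z in U, f z * wder m φ z = - ∫ z in U, F z * φ z

def LocL2On {n : ℕ} (U : Set (Cn n)) (f : Cn n → ℂ) : Prop :=
  ∀ K, IsCompact K → K ⊆ U → (∫⁻ z in K, (‖f z‖₊ : ℝ≥0∞) ^ 2) < ⊤

def LocL1On {n : ℕ} (U : Set (Cn n)) (f : Cn n → ℂ) : Prop :=
  ∀ K, IsCompact K → K ⊆ U → (∫⁻ z in K, (‖f z‖₊ : ℝ≥0∞)) < ⊤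
/-- `hs` is a sequence of smooth Griffiths semi-negative metrics decreasing (in the sense of
Hermitian forms) pointwise to `h` on `U`. -/
def DecreasingApproxOn {n r : ℕ} (U : Set (Cn n)) (h : Cn n → Matrix (Fin r) (Fin r) ℂ)
    (hs : ℕ → Cn n → Matrix (Fin r) (Fin r) ℂ) : Prop :=
  (∀ ν, SmoothMetricOn U (hs ν)) ∧ (∀ ν, GriffithsSemiNegOn U (hs ν)) ∧
  (∀ z ∈ U, ∀ ν, (hs ν z - hs (ν + 1) z).PosSemidef) ∧
  (∀ z ∈ U, ∀ i j, Filter.Tendsto (fun ν => hs ν z i j) Filter.atTop (nhds (h z i j)))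

/-- On a compact metric space, a bounded upper semicontinuous function is a pointwise limit of
uniformly bounded continuous functions dominating it. -/
theorem exists_continuous_seq_tendsto_of_upperSemicontinuous {X : Type*} [PseudoMetricSpace X]
    {g : X → ℝ} (hg : UpperSemicontinuous g) {M : ℝ} (h0 : ∀ x, 0 ≤ g x) (hM : ∀ x, g x ≤ M) :
    ∃ p : ℕ → X → ℝ, (∀ k, Continuous (p k)) ∧ (∀ k x, g x ≤ p k x) ∧ (∀ k x, p k x ≤ M) ∧
      ∀ x, Tendsto (fun k => p k x) atTop (𝓝 (g x)) := by
  have hbdd : ∀ (k : ℕ) (x : X), BddAbove (Set.range fun y => g y - k * dist x y) := by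
    intro k x
    refine ⟨M, ?_⟩
    rintro _ ⟨y, rfl⟩
    have : 0 ≤ (k : ℝ) * dist x y := by positivity
    simp only
    linarith [hM y]
  have hle : ∀ (k : ℕ) x, g x ≤ ⨆ y, (g y - k * dist x y) := by
    intro k x
    have := le_ciSup (hbdd k x) x
    simpa using this
  refine ⟨fun k x => ⨆ y, (g y - k * dist x y), fun k => ?_, hle, fun k x => ?_, fun x => ?_⟩
  · refine (LipschitzWith.of_le_add_mul (k : ℝ≥0) fun x x' => ?_).continuous
    have : Nonempty X := ⟨x⟩
    refine ciSup_le fun y => ?_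
    have h1 := le_ciSup (hbdd k x') y
    have h2 := dist_triangle x' x y
    have h3 : (k : ℝ) * dist x' y ≤ k * (dist x' x + dist x y) := by gcongr
    rw [dist_comm x' x] at h3
    simp only [NNReal.coe_natCast] at *
    linarith
  · have : Nonempty X := ⟨x⟩
    refine ciSup_le fun y => ?_
    have : 0 ≤ (k : ℝ) * dist x y := by positivity
    linarith [hM y]
  · have : Nonempty X := ⟨x⟩
    refine tendsto_order.2 ⟨fun a ha => Eventually.of_forall fun k => ha.trans_le (hle k x),
      fun a ha => ?_⟩
    obtain ⟨b, hb, hba⟩ := exists_between ha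
    obtain ⟨δ, hδ, hball⟩ := Metric.eventually_nhds_iff.1 (hg x b hb)
    obtain ⟨k₀, hk₀⟩ := exists_nat_gt (M / δ)
    filter_upwards [eventually_ge_atTop k₀] with k hk
    refine lt_of_le_of_lt (ciSup_le fun y => ?_) hba
    by_cases hy : dist y x < δ
    · have : 0 ≤ (k : ℝ) * dist x y := by positivity
      linarith [hball hy]
    · rw [not_lt, dist_comm] at hy
      have h1 : M < k₀ * δ := (div_lt_iff₀ hδ).1 hk₀
      have h2 : (k₀ : ℝ) * δ ≤ k * dist x y := by
        have : (k₀ : ℝ) ≤ k := by exact_mod_cast hk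
        gcongr
      linarith [hM y, h0 x]

/-- The rotation-invariant probability measure on the unit circle. -/
abbrev circleHaar : Measure UnitAddCircle := AddCircle.haarAddCircle

/-- The standard parametrization of the unit circle. -/
def circlePt (θ : UnitAddCircle) : ℂ := (fourier 1 : C(UnitAddCircle, ℂ)) θ

theorem continuous_circlePt : Continuous circlePt := (fourier 1 : C(UnitAddCircle, ℂ)).continuous

theorem norm_circlePt (θ : UnitAddCircle) : ‖circlePt θ‖ = 1 := by
  rw [circlePt, fourier_apply]
  exact Circle.norm_coe _

theorem circlePt_add_half (θ : UnitAddCircle) :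
    circlePt (θ + ((1 / 2 : ℝ) : UnitAddCircle)) = -circlePt θ := by
  have := @fourier_add_half_inv_index 1 1 one_ne_zero one_pos θ
  simpa [circlePt] using this

theorem fourier_natCast_eq_pow (k : ℕ) (θ : UnitAddCircle) :
    (fourier (k : ℤ) : C(UnitAddCircle, ℂ)) θ = circlePt θ ^ k := by
  induction k with
  | zero => simp
  | succ k ih => rw [Nat.cast_succ, fourier_add, ih, pow_succ]; rfl

theorem integral_fourier_circleHaar (k : ℤ) :
    ∫ θ, (fourier k : C(UnitAddCircle, ℂ)) θ ∂circleHaar = if k = 0 then 1 else 0 := by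
  have := congrFun (fourierCoeff_fourier (T := 1) k) 0
  simpa [fourierCoeff, Pi.single_apply, eq_comm] using this

theorem integral_circlePt : ∫ θ, circlePt θ ∂circleHaar = 0 := by
  simpa [circlePt] using integral_fourier_circleHaar 1

theorem integral_conj_circlePt_sq :
    ∫ θ, (starRingEnd ℂ) (circlePt θ) * (starRingEnd ℂ) (circlePt θ) ∂circleHaar = 0 := by
  have h : ∀ θ, (starRingEnd ℂ) (circlePt θ) * (starRingEnd ℂ) (circlePt θ) =
      (fourier (-2) : C(UnitAddCircle, ℂ)) θ := by
    intro θ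
    rw [circlePt, ← fourier_neg, ← fourier_add]
    norm_num
  simp_rw [h]
  simpa using integral_fourier_circleHaar (-2)

theorem integral_conj_circlePt : ∫ θ, (starRingEnd ℂ) (circlePt θ) ∂circleHaar = 0 := by
  rw [integral_conj, integral_circlePt, map_zero]

/-- A trigonometric polynomial is the boundary value of the sum of a holomorphic and an
antiholomorphic function, whose value at the centre is the mean. -/
theorem exists_differentiable_of_mem_span_fourier {ρ : ℝ} (hρ : 0 < ρ) {q : C(UnitAddCircle, ℂ)}
    (hq : q ∈ Submodule.span ℂ (Set.range (fourier (T := 1)))) :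
    ∃ F₁ F₂ : ℂ → ℂ, Differentiable ℂ F₁ ∧ Differentiable ℂ F₂ ∧
      (∀ θ, q θ = F₁ (ρ * circlePt θ) + (starRingEnd ℂ) (F₂ (ρ * circlePt θ))) ∧
      ∫ θ, q θ ∂circleHaar = F₁ 0 + (starRingEnd ℂ) (F₂ 0) := by
  have hρ' : (ρ : ℂ) ≠ 0 := by exact_mod_cast hρ.ne'
  induction hq using Submodule.span_induction with
  | mem x hx =>
    obtain ⟨k, rfl⟩ := hx
    rw [integral_fourier_circleHaar]
    obtain ⟨j, rfl | rfl⟩ := k.eq_nat_or_neg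
    · refine ⟨fun w => (w / ρ) ^ j, fun _ => 0, by fun_prop, by fun_prop, fun θ => ?_, ?_⟩
      · rw [fourier_natCast_eq_pow]
        simp [mul_div_cancel_left₀ _ hρ']
      · simp [zero_pow_eq]
    · refine ⟨fun _ => 0, fun w => (w / ρ) ^ j, by fun_prop, by fun_prop, fun θ => ?_, ?_⟩
      · rw [fourier_neg, fourier_natCast_eq_pow]
        simp [mul_div_cancel_left₀ _ hρ']
      · simp [zero_pow_eq]
  | zero => exact ⟨0, 0, by fun_prop, by fun_prop, by simp, by simp⟩
  | add x y _ _ hx hy =>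
    obtain ⟨F₁, F₂, h1, h2, h3, h4⟩ := hx
    obtain ⟨G₁, G₂, k1, k2, k3, k4⟩ := hy
    refine ⟨F₁ + G₁, F₂ + G₂, h1.add k1, h2.add k2, fun θ => ?_, ?_⟩
    · simp [h3, k3]; ring
    · have hint : ∀ z : C(UnitAddCircle, ℂ), Integrable z circleHaar := fun z =>
        z.continuous.integrable_of_hasCompactSupport (HasCompactSupport.of_compactSpace z)
      simp only [ContinuousMap.add_apply]
      rw [integral_add (hint x) (hint y), h4, k4]
      simp; ring
  | smul a x _ hx =>
    obtain ⟨F₁, F₂, h1, h2, h3, h4⟩ := hx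
    refine ⟨fun w => a * F₁ w, fun w => (starRingEnd ℂ) a * F₂ w, h1.const_mul _, h2.const_mul _,
      fun θ => ?_, ?_⟩
    · simp [h3]; ring
    · simp only [ContinuousMap.smul_apply, smul_eq_mul, map_mul, Complex.conj_conj]
      rw [integral_const_mul, h4]; ring

/-- The mean value inequality for upper semicontinuous functions, deduced from comparison with
real parts of holomorphic functions. -/
theorem le_integral_circle_of_forall_holomorphic {ρ c M : ℝ} (hρ : 0 < ρ) {f : ℂ → ℝ}
    (husc : UpperSemicontinuous fun θ => f (ρ * circlePt θ))
    (h0 : ∀ θ, 0 ≤ f (ρ * circlePt θ)) (hM : ∀ θ, f (ρ * circlePt θ) ≤ M)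
    (hc : ∀ F : ℂ → ℂ, Differentiable ℂ F → (∀ θ, f (ρ * circlePt θ) ≤ (F (ρ * circlePt θ)).re) →
      c ≤ (F 0).re) :
    c ≤ ∫ θ, f (ρ * circlePt θ) ∂circleHaar := by
  have hint : ∀ z : C(UnitAddCircle, ℂ), Integrable z circleHaar := fun z =>
    z.continuous.integrable_of_hasCompactSupport (HasCompactSupport.of_compactSpace z)
  have hcont : ∀ p : UnitAddCircle → ℝ, Continuous p → (∀ θ, f (ρ * circlePt θ) ≤ p θ) →
      c ≤ ∫ θ, p θ ∂circleHaar := by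
    intro p hp hfp
    refine le_of_forall_pos_le_add fun δ hδ => ?_
    let P : C(UnitAddCircle, ℂ) := ⟨fun θ => (p θ : ℂ), by fun_prop⟩
    have hPmem : P ∈ (Submodule.span ℂ (Set.range (fourier (T := 1)))).topologicalClosure := by
      rw [span_fourier_closure_eq_top]; trivial
    obtain ⟨q, hq, hPq⟩ := Metric.mem_closure_iff.1 hPmem (δ / 2) (by positivity)
    obtain ⟨F₁, F₂, hF₁, hF₂, hb, hm⟩ := exists_differentiable_of_mem_span_fourier hρ hq
    have hdist : ∀ θ, |p θ - (q θ).re| ≤ δ / 2 := fun θ => by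
      have h1 : dist (P θ) (q θ) ≤ dist P q := ContinuousMap.dist_apply_le_dist θ
      have h2 := Complex.abs_re_le_norm (P θ - q θ)
      rw [dist_eq_norm] at h1
      have h3 : (P θ - q θ).re = p θ - (q θ).re := by simp [P]
      rw [h3] at h2
      linarith
    have key := hc (fun w => F₁ w + F₂ w + (δ / 2 : ℝ)) (by fun_prop) fun θ => by
      have h1 := congrArg Complex.re (hb θ)
      have h2 := abs_le.1 (hdist θ)
      simp only [Complex.add_re, Complex.conj_re, Complex.ofReal_re] at h1 ⊢
      linarith [hfp θ]
    have hq' : ∫ θ, (q θ).re ∂circleHaar = (F₁ 0).re + (F₂ 0).re := by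
      have := congrArg Complex.re hm
      simp only [Complex.add_re, Complex.conj_re] at this
      rw [← this]
      exact integral_re (hint q)
    have hqp : ∫ θ, (q θ).re ∂circleHaar ≤ ∫ θ, (p θ + δ / 2) ∂circleHaar := by
      refine integral_mono (hint q).re ?_ fun θ => ?_
      · exact ((hp.integrable_of_hasCompactSupport (HasCompactSupport.of_compactSpace p))).add
          (integrable_const _)
      · have h2 := abs_le.1 (hdist θ)
        simp only
        linarith
    rw [integral_add (hp.integrable_of_hasCompactSupport (HasCompactSupport.of_compactSpace p))
      (integrable_const _)] at hqp
    simp only [integral_const, probReal_univ, smul_eq_mul, one_mul] at hqp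
    simp only [Complex.add_re, Complex.ofReal_re] at key
    linarith
  obtain ⟨p, hpc, hgp, hpM, hlim⟩ :=
    exists_continuous_seq_tendsto_of_upperSemicontinuous husc h0 hM
  refine ge_of_tendsto' (tendsto_integral_of_dominated_convergence (fun _ => M)
    (fun k => (hpc k).aestronglyMeasurable) (integrable_const _) (fun k => ?_)
    (Eventually.of_forall hlim)) fun k => hcont _ (hpc k) (hgp k)
  refine Eventually.of_forall fun θ => ?_
  rw [Real.norm_eq_abs, abs_of_nonneg ((h0 θ).trans (hgp k θ))]
  exact hpM k θ

theorem norm_basisV_le {n : ℕ} (m : Fin n) : ‖basisV m‖ ≤ 1 := by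
  refine (pi_norm_le_iff_of_nonneg zero_le_one).2 fun k => ?_
  unfold basisV
  split_ifs <;> simp

/-- Displacement by `ε` in the direction `θ` of the `m`-th coordinate line. -/
def circleShift {n : ℕ} (m : Fin n) (ε : ℝ) (θ : UnitAddCircle) : Cn n :=
  ((ε : ℂ) * circlePt θ) • basisV m

theorem continuous_circleShift {n : ℕ} (m : Fin n) (ε : ℝ) : Continuous (circleShift m ε) :=
  (continuous_const.mul continuous_circlePt).smul continuous_const

theorem norm_circleShift_le {n : ℕ} (m : Fin n) {ε : ℝ} (hε : 0 ≤ ε) (θ : UnitAddCircle) :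
    ‖circleShift m ε θ‖ ≤ ε := by
  rw [circleShift, norm_smul, norm_mul, norm_circlePt, Complex.norm_real, Real.norm_eq_abs,
    abs_of_nonneg hε, mul_one]
  exact mul_le_of_le_one_right hε (norm_basisV_le m)

theorem circleShift_add_half {n : ℕ} (m : Fin n) (ε : ℝ) (θ : UnitAddCircle) :
    circleShift m ε (θ + ((1 / 2 : ℝ) : UnitAddCircle)) = -circleShift m ε θ := by
  rw [circleShift, circlePt_add_half, mul_neg, neg_smul, circleShift]

theorem integral_comp_neg_circleShift {E : Type*} [NormedAddCommGroup E] [NormedSpace ℝ E]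
    {n : ℕ} (m : Fin n) (ε : ℝ) (F : Cn n → E) :
    ∫ θ, F (-circleShift m ε θ) ∂circleHaar = ∫ θ, F (circleShift m ε θ) ∂circleHaar := by
  simp_rw [← circleShift_add_half]
  exact integral_add_right_eq_self (fun θ => F (circleShift m ε θ)) _

theorem exists_circlePt_eq {ρ : ℝ} (hρ : 0 < ρ) {w : ℂ} (hw : ‖w‖ = ρ) :
    ∃ θ, (ρ : ℂ) * circlePt θ = w := by
  have hρ' : (ρ : ℂ) ≠ 0 := by exact_mod_cast hρ.ne'
  let c : Circle := ⟨w / ρ, by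
    rw [Submonoid.unitSphere, Submonoid.mem_mk, Subsemigroup.mem_mk, mem_sphere_zero_iff_norm]
    rw [norm_div, hw, Complex.norm_real, Real.norm_eq_abs, abs_of_pos hρ, div_self hρ.ne']⟩
  obtain ⟨θ, hθ⟩ := (AddCircle.homeomorphCircle (T := 1) one_ne_zero).surjective c
  refine ⟨θ, ?_⟩
  have h : circlePt θ = w / ρ := by
    rw [circlePt, fourier_one, ← AddCircle.homeomorphCircle_apply (T := 1) one_ne_zero, hθ]
  rw [h, mul_div_cancel₀ _ hρ']

/-- Mean value inequality for bounded plurisubharmonic functions on circles in a coordinate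
direction. -/
theorem PshOnR.le_integral_circleShift {n : ℕ} {U : Set (Cn n)} {f : Cn n → ℝ} (hf : PshOnR f U)
    (m : Fin n) {ε M : ℝ} (hε : 0 < ε) {z : Cn n} (hz : z ∈ U)
    (hU : ∀ w : ℂ, ‖w‖ ≤ ε → z + w • basisV m ∈ U)
    (h0 : ∀ θ, 0 ≤ f (z + circleShift m ε θ)) (hM : ∀ θ, f (z + circleShift m ε θ) ≤ M) :
    f z ≤ ∫ θ, f (z + circleShift m ε θ) ∂circleHaar := by
  have hnorm : ∀ θ, ‖(ε : ℂ) * circlePt θ‖ = ε := fun θ => by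
    rw [norm_mul, norm_circlePt, Complex.norm_real, Real.norm_eq_abs, abs_of_pos hε, mul_one]
  refine le_integral_circle_of_forall_holomorphic (f := fun w => f (z + w • basisV m)) hε ?_ h0 hM
    fun F hF hfF => ?_
  · intro θ y hy
    have h1 := hf.1 (z + ((ε : ℂ) * circlePt θ) • basisV m) (hU _ (hnorm θ).le) y
      (EReal.coe_lt_coe_iff.2 hy)
    have h2 : Tendsto (fun θ' => z + ((ε : ℂ) * circlePt θ') • basisV m) (𝓝 θ)
        (𝓝[U] (z + ((ε : ℂ) * circlePt θ) • basisV m)) := by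
      refine tendsto_nhdsWithin_iff.2 ⟨?_, Eventually.of_forall fun θ' => hU _ (hnorm θ').le⟩
      exact (continuous_const.add (continuous_circleShift m ε)).tendsto θ
    filter_upwards [h2.eventually h1] with θ' h
    exact EReal.coe_lt_coe_iff.1 h
  · refine EReal.coe_le_coe_iff.1 (hf.2 z hz (basisV m) ε hε hU F hF.continuous.continuousOn
      hF.differentiableOn fun w hw => ?_)
    obtain ⟨θ, rfl⟩ := exists_circlePt_eq hε hw
    exact EReal.coe_le_coe_iff.2 (hfF θ)

theorem integrable_of_bounded_of_eq_zero {α E : Type*} [MeasurableSpace α] {μ : Measure α}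
    [NormedAddCommGroup E] {S : Set α} (hS : μ S ≠ ⊤) {F : α → E}
    (hF : AEStronglyMeasurable F μ) {B : ℝ} (hB : ∀ x ∈ S, ‖F x‖ ≤ B) (h0 : ∀ x ∉ S, F x = 0) :
    Integrable F μ := by
  refine (integrableOn_iff_integrable_of_support_subset (s := toMeasurable μ S) ?_).1 ?_
  · intro x hx
    by_contra h
    exact hx (h0 x fun h' => h (subset_toMeasurable μ S h'))
  · refine Measure.integrableOn_of_bounded (M := max B 0) (by rwa [measure_toMeasurable]) hF ?_
    refine Eventually.of_forall fun x => ?_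
    by_cases hx : x ∈ S
    · exact (hB x hx).trans (le_max_left _ _)
    · simp [h0 x hx]

/-- First order Taylor estimate for compactly supported smooth functions. -/
theorem exists_taylor_bound_of_hasCompactSupport {V E : Type*} [NormedAddCommGroup V]
    [NormedSpace ℝ V] [NormedAddCommGroup E] [NormedSpace ℝ E]
    {χ : V → E} (hχ : ContDiff ℝ (⊤ : ℕ∞) χ) (hc : HasCompactSupport χ) :
    ∃ C : ℝ, 0 ≤ C ∧ ∀ z v, ‖χ (z + v) - χ z - fderiv ℝ χ z v‖ ≤ C * ‖v‖ ^ 2 := by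
  obtain ⟨C, hC⟩ := ContDiff.lipschitzWith_of_hasCompactSupport (hc.fderiv ℝ)
    (hχ.fderiv_right (m := 1) (by norm_num; exact WithTop.coe_le_coe.2 le_top)) one_ne_zero
  refine ⟨C, C.2, fun z v => ?_⟩
  have := (convex_closedBall z ‖v‖).norm_image_sub_le_of_norm_hasFDerivWithin_le'
    (f := χ) (f' := fderiv ℝ χ) (φ := fderiv ℝ χ z) (C := C * ‖v‖) (x := z) (y := z + v)
    (fun x _ => (hχ.differentiable (by simp) x).hasFDerivAt.hasFDerivWithinAt)
    (fun x hx => ?_) (by simp) (by simp)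
  · simpa [pow_two, mul_assoc] using this
  · rw [← dist_eq_norm]
    exact (hC.dist_le_mul x z).trans (by gcongr; exact hx)

/-- The mean of a smooth function over a small circle differs from the central value to second
order only. -/
theorem exists_abs_integral_circleShift_sub_le {n : ℕ} (m : Fin n) {χ : Cn n → ℝ}
    (hχ : ContDiff ℝ (⊤ : ℕ∞) χ) (hc : HasCompactSupport χ) :
    ∃ C : ℝ, 0 ≤ C ∧ ∀ ε : ℝ, 0 ≤ ε → ∀ z,
      |∫ θ, (χ (z + circleShift m ε θ) - χ z) ∂circleHaar| ≤ C * ε ^ 2 := by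
  obtain ⟨C, hC0, hC⟩ := exists_taylor_bound_of_hasCompactSupport hχ hc
  refine ⟨C, hC0, fun ε hε z => ?_⟩
  have hlin : ∫ θ, fderiv ℝ χ z (circleShift m ε θ) ∂circleHaar = 0 := by
    have h1 := integral_comp_neg_circleShift m ε (fun v => fderiv ℝ χ z v)
    simp only [map_neg, integral_neg] at h1
    linarith
  have hcs : ∀ g : UnitAddCircle → ℝ, Continuous g → Integrable g circleHaar := fun g hg =>
    hg.integrable_of_hasCompactSupport (HasCompactSupport.of_compactSpace g)
  have hs := continuous_circleShift m ε
  have hχc := hχ.continuous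
  have h2 : ∫ θ, (χ (z + circleShift m ε θ) - χ z) ∂circleHaar =
      ∫ θ, (χ (z + circleShift m ε θ) - χ z - fderiv ℝ χ z (circleShift m ε θ)) ∂circleHaar := by
    rw [integral_sub (hcs (fun θ => χ (z + circleShift m ε θ) - χ z) (by fun_prop))
      (hcs (fun θ => fderiv ℝ χ z (circleShift m ε θ)) (by fun_prop)), hlin, sub_zero]
  rw [h2, ← Real.norm_eq_abs]
  refine (norm_integral_le_of_norm_le_const (C := C * ε ^ 2)
    (Eventually.of_forall fun θ => ?_)).trans (by simp)
  refine (hC z _).trans ?_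
  gcongr
  exact norm_circleShift_le m hε θ

/-- Discrete Caccioppoli inequality for bounded nonnegative plurisubharmonic functions: weighted
squares of differences over circles of radius `ε` are `O(ε²)`. -/
theorem PshOnR.integral_circle_sq_sub_le {n : ℕ} {U L : Set (Cn n)} {f : Cn n → ℝ}
    (hf : PshOnR f U) (hfm : Measurable f) (m : Fin n) (hL : IsCompact L) (hLU : L ⊆ U) {M : ℝ}
    (h0 : ∀ z ∈ L, 0 ≤ f z) (hM : ∀ z ∈ L, f z ≤ M)
    {χ : Cn n → ℝ} (hχ : Continuous χ) (hχ0 : ∀ z, 0 ≤ χ z) (hχ1 : ∀ z, χ z ≤ 1) {C ε : ℝ}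
    (hε : 0 < ε)
    (hC : ∀ z, |∫ θ, (χ (z + circleShift m ε θ) - χ z) ∂circleHaar| ≤ C * ε ^ 2)
    (hLε : ∀ z ∈ tsupport χ, ∀ w : ℂ, ‖w‖ ≤ ε → z + w • basisV m ∈ L) :
    Integrable (fun p : Cn n × UnitAddCircle =>
      χ p.1 * (L.indicator f (p.1 + circleShift m ε p.2) - L.indicator f p.1) ^ 2)
      (volume.prod circleHaar) ∧
    ∫ z, ∫ θ, χ z * (L.indicator f (z + circleShift m ε θ) - L.indicator f z) ^ 2 ∂circleHaar
      ≤ M ^ 2 * (C * ε ^ 2) * volume.real L := by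
  have hLm : MeasurableSet L := hL.measurableSet
  have hLt : volume L ≠ ⊤ := hL.measure_lt_top.ne
  set g : Cn n → ℝ := L.indicator f with hg
  have hgm : Measurable g := hfm.indicator hLm
  have hsupp : tsupport χ ⊆ L := fun z hz => by
    simpa using hLε z hz 0 (by simpa using hε.le)
  rcases L.eq_empty_or_nonempty with hLe | ⟨z₀, hz₀⟩
  · have hχz : χ = 0 := by
      rw [hLe, Set.subset_empty_iff, tsupport_eq_empty_iff] at hsupp
      exact hsupp
    simp [hχz, hLe]
  have hM0 : 0 ≤ M := (h0 z₀ hz₀).trans (hM z₀ hz₀)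
  have hg0 : ∀ z, 0 ≤ g z := fun z => Set.indicator_nonneg h0 z
  have hgM : ∀ z, g z ≤ M := fun z => Set.indicator_le' hM (fun _ _ => hM0) z
  have hgabs : ∀ z, |g z| ≤ M := fun z => by rw [abs_of_nonneg (hg0 z)]; exact hgM z
  have hg2 : ∀ z, g z ^ 2 ≤ M ^ 2 := fun z => pow_le_pow_left₀ (hg0 z) (hgM z) 2
  have hs := continuous_circleShift m ε
  have hshift : Measurable fun p : Cn n × UnitAddCircle => g (p.1 + circleShift m ε p.2) :=
    hgm.comp (by fun_prop : Continuous fun p : Cn n × UnitAddCircle =>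
      p.1 + circleShift m ε p.2).measurable
  have hχp : Measurable fun p : Cn n × UnitAddCircle => χ p.1 := hχ.measurable.comp measurable_fst
  have hgp : Measurable fun p : Cn n × UnitAddCircle => g p.1 := hgm.comp measurable_fst
  have hprod : (volume.prod circleHaar) (L ×ˢ (Set.univ : Set UnitAddCircle)) ≠ ⊤ := by
    rw [Measure.prod_prod]; simp [hLt]
  have hχL : ∀ z ∉ L, χ z = 0 := fun z hz => image_eq_zero_of_notMem_tsupport fun h => hz (hsupp h)
  have hintθ : ∀ F : UnitAddCircle → ℝ, Measurable F → ∀ B : ℝ, (∀ θ, |F θ| ≤ B) →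
      Integrable F circleHaar := fun F hF B hB =>
    integrable_of_bounded_of_eq_zero (S := Set.univ) (measure_ne_top _ _)
      hF.aestronglyMeasurable (fun x _ => hB x) (by simp)
  have hgθ : ∀ z, Measurable fun θ => g (z + circleShift m ε θ) := fun z =>
    hgm.comp (by fun_prop : Continuous fun θ => z + circleShift m ε θ).measurable
  have hI1 : Integrable (fun p : Cn n × UnitAddCircle =>
      χ p.1 * (g (p.1 + circleShift m ε p.2) - g p.1) ^ 2) (volume.prod circleHaar) := by
    refine integrable_of_bounded_of_eq_zero (B := M ^ 2) hprod
      (hχp.mul ((hshift.sub hgp).pow_const 2)).aestronglyMeasurable ?_ ?_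
    · rintro ⟨z, θ⟩ _
      rw [Real.norm_eq_abs, abs_mul, abs_of_nonneg (hχ0 _), abs_of_nonneg (sq_nonneg _)]
      have h1 : (g (z + circleShift m ε θ) - g z) ^ 2 ≤ M ^ 2 := by
        refine sq_le_sq' ?_ ?_ <;>
          linarith [hg0 z, hgM z, hg0 (z + circleShift m ε θ), hgM (z + circleShift m ε θ)]
      exact (mul_le_of_le_one_left (sq_nonneg _) (hχ1 z)).trans h1
    · rintro ⟨z, θ⟩ hz
      simp only [Set.mem_prod, Set.mem_univ, and_true] at hz
      simp [hχL z hz]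
  have hI2 : Integrable (fun p : Cn n × UnitAddCircle =>
      χ p.1 * g (p.1 + circleShift m ε p.2) ^ 2) (volume.prod circleHaar) := by
    refine integrable_of_bounded_of_eq_zero (B := M ^ 2) hprod
      (hχp.mul (hshift.pow_const 2)).aestronglyMeasurable ?_ ?_
    · rintro ⟨z, θ⟩ _
      rw [Real.norm_eq_abs, abs_mul, abs_of_nonneg (hχ0 _), abs_of_nonneg (sq_nonneg _)]
      exact (mul_le_of_le_one_left (sq_nonneg _) (hχ1 z)).trans (hg2 _)
    · rintro ⟨z, θ⟩ hz
      simp only [Set.mem_prod, Set.mem_univ, and_true] at hz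
      simp [hχL z hz]
  have hI3 : Integrable (fun z => χ z * g z ^ 2) := by
    refine integrable_of_bounded_of_eq_zero (B := M ^ 2) hLt
      (hχ.measurable.mul (hgm.pow_const 2)).aestronglyMeasurable ?_ fun z hz => by simp [hχL z hz]
    intro z _
    rw [Real.norm_eq_abs, abs_mul, abs_of_nonneg (hχ0 _), abs_of_nonneg (sq_nonneg _)]
    exact (mul_le_of_le_one_left (sq_nonneg _) (hχ1 z)).trans (hg2 _)
  refine ⟨hI1, ?_⟩
  have hpt : ∀ z, ∫ θ, χ z * (g (z + circleShift m ε θ) - g z) ^ 2 ∂circleHaar ≤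
      ∫ θ, χ z * g (z + circleShift m ε θ) ^ 2 ∂circleHaar - χ z * g z ^ 2 := by
    intro z
    rw [integral_const_mul, integral_const_mul, ← mul_sub]
    by_cases hz : z ∈ tsupport χ
    · refine mul_le_mul_of_nonneg_left ?_ (hχ0 z)
      have hmem : ∀ θ, z + circleShift m ε θ ∈ L := fun θ => hLε z hz _ (by
        rw [norm_mul, norm_circlePt, Complex.norm_real, Real.norm_eq_abs, abs_of_pos hε, mul_one])
      have hsub : g z ≤ ∫ θ, g (z + circleShift m ε θ) ∂circleHaar := by
        have h1 := hf.le_integral_circleShift m hε (hLU (hsupp hz))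
          (fun w hw => hLU (hLε z hz w hw)) (fun θ => h0 _ (hmem θ)) (fun θ => hM _ (hmem θ))
        simpa [hg, Set.indicator_of_mem (hsupp hz), Set.indicator_of_mem (hmem _)] using h1
      have hi1 := hintθ _ ((hgθ z).pow_const 2) (M ^ 2) fun θ => by
        rw [abs_of_nonneg (sq_nonneg _)]; exact hg2 _
      have hi2 := hintθ _ (hgθ z) M fun θ => hgabs _
      have hexp : ∀ θ, (g (z + circleShift m ε θ) - g z) ^ 2 =
          g (z + circleShift m ε θ) ^ 2 - (2 * g z) * g (z + circleShift m ε θ) + g z ^ 2 :=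
        fun θ => by ring
      simp_rw [hexp]
      have hi3 : Integrable (fun θ => g (z + circleShift m ε θ) ^ 2 -
          (2 * g z) * g (z + circleShift m ε θ)) circleHaar := hi1.sub (hi2.const_mul _)
      rw [integral_add hi3 (integrable_const _), integral_sub hi1 (hi2.const_mul _),
        integral_const_mul]
      simp only [integral_const, probReal_univ, smul_eq_mul, one_mul]
      nlinarith [mul_le_mul_of_nonneg_left hsub (hg0 z)]
    · simp [image_eq_zero_of_notMem_tsupport hz]
  have hstep1 : ∫ z, ∫ θ, χ z * (g (z + circleShift m ε θ) - g z) ^ 2 ∂circleHaar ≤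
      (∫ z, ∫ θ, χ z * g (z + circleShift m ε θ) ^ 2 ∂circleHaar) - ∫ z, χ z * g z ^ 2 := by
    rw [← integral_sub hI2.integral_prod_left hI3]
    exact integral_mono hI1.integral_prod_left (hI2.integral_prod_left.sub hI3) hpt
  refine hstep1.trans ?_
  have htrans : ∀ θ, ∫ z, χ z * g (z + circleShift m ε θ) ^ 2 =
      ∫ z, χ (z - circleShift m ε θ) * g z ^ 2 := fun θ => by
    rw [← integral_add_right_eq_self (fun z => χ (z - circleShift m ε θ) * g z ^ 2)
      (circleShift m ε θ)]
    simp
  have hI4 : Integrable (fun p : Cn n × UnitAddCircle =>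
      χ (p.1 - circleShift m ε p.2) * g p.1 ^ 2) (volume.prod circleHaar) := by
    refine integrable_of_bounded_of_eq_zero (B := M ^ 2) hprod
      (((by fun_prop : Continuous fun p : Cn n × UnitAddCircle =>
        χ (p.1 - circleShift m ε p.2)).measurable).mul (hgp.pow_const 2)).aestronglyMeasurable ?_ ?_
    · rintro ⟨z, θ⟩ _
      rw [Real.norm_eq_abs, abs_mul, abs_of_nonneg (hχ0 _), abs_of_nonneg (sq_nonneg _)]
      exact (mul_le_of_le_one_left (sq_nonneg _) (hχ1 _)).trans (hg2 _)
    · rintro ⟨z, θ⟩ hz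
      simp only [Set.mem_prod, Set.mem_univ, and_true] at hz
      simp [hg, Set.indicator_of_notMem hz]
  have hI5 : Integrable fun z => g z ^ 2 :=
    integrable_of_bounded_of_eq_zero (B := M ^ 2) hLt (hgm.pow_const 2).aestronglyMeasurable
      (fun z _ => by rw [Real.norm_eq_abs, abs_of_nonneg (sq_nonneg _)]; exact hg2 z)
      fun z hz => by simp [hg, Set.indicator_of_notMem hz]
  rw [integral_integral_swap hI2]
  simp_rw [htrans]
  rw [← integral_integral_swap hI4, ← integral_sub hI4.integral_prod_left hI3]
  have hpt2 : ∀ z, (∫ θ, χ (z - circleShift m ε θ) * g z ^ 2 ∂circleHaar) - χ z * g z ^ 2 ≤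
      L.indicator (fun _ => M ^ 2 * (C * ε ^ 2)) z := by
    intro z
    by_cases hz : z ∈ L
    · rw [Set.indicator_of_mem hz, integral_mul_const, ← sub_mul]
      have h1 : ∫ θ, χ (z - circleShift m ε θ) ∂circleHaar - χ z =
          ∫ θ, (χ (z + circleShift m ε θ) - χ z) ∂circleHaar := by
        rw [integral_sub (hintθ _ (by fun_prop : Continuous fun θ =>
          χ (z + circleShift m ε θ)).measurable 1 fun θ => by
            rw [abs_of_nonneg (hχ0 _)]; exact hχ1 _) (integrable_const _)]
        have := integral_comp_neg_circleShift m ε (fun v => χ (z + v))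
        simp only [← sub_eq_add_neg] at this
        rw [this]; simp
      rw [h1, mul_comm]
      have h2 := (abs_le.1 (hC z)).2
      have h3 : 0 ≤ C * ε ^ 2 := (abs_nonneg _).trans (hC z)
      exact (mul_le_mul_of_nonneg_left h2 (sq_nonneg _)).trans
        (mul_le_mul_of_nonneg_right (hg2 z) h3)
    · simp [hg, Set.indicator_of_notMem hz]
  refine (integral_mono (hI4.integral_prod_left.sub hI3)
    ((integrable_indicator_iff hLm).2 (integrableOn_const hLt)) hpt2).trans ?_
  rw [integral_indicator hLm, setIntegral_const, smul_eq_mul, mul_comm]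

theorem sqNorm_sub {r : ℕ} (A A' : Matrix (Fin r) (Fin r) ℂ) (v : Fin r → ℂ) :
    sqNorm (A - A') v = sqNorm A v - sqNorm A' v := by
  simp [sqNorm, Matrix.sub_mulVec, dotProduct_sub]

theorem sqNorm_nonneg {r : ℕ} {A : Matrix (Fin r) (Fin r) ℂ} (hA : A.PosSemidef)
    (v : Fin r → ℂ) : 0 ≤ sqNorm A v :=
  (Complex.le_def.1 (hA.dotProduct_mulVec_nonneg v)).1

/-- Vectors `e_i + c e_j`, `c ∈ {0, 1, √-1}`, recovering a Hermitian form by polarization. -/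
def polVec {r : ℕ} (a : Fin r × Fin r × Fin 3) : Fin r → ℂ :=
  Pi.single a.1 1 + (![0, 1, Complex.I] a.2.2) • Pi.single a.2.1 1

theorem sqNorm_single_add_smul_single {r : ℕ} (A : Matrix (Fin r) (Fin r) ℂ) (i j : Fin r)
    (c : ℂ) :
    sqNorm A (Pi.single i 1 + c • Pi.single j 1) =
      (A i i + c * A i j + (starRingEnd ℂ) c * A j i + (starRingEnd ℂ) c * c * A j j).re := by
  rw [sqNorm]
  congr 1
  simp only [star_add, star_smul, Matrix.mulVec_add, Matrix.mulVec_smul, dotProduct_add,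
    add_dotProduct, smul_dotProduct, dotProduct_smul, Pi.star_single, star_one,
    single_dotProduct, Matrix.mulVec_single_one, Matrix.col_apply, smul_eq_mul, one_mul,
    starRingEnd_apply]
  ring

/-- Polarization: entries of a Hermitian matrix are controlled by finitely many values of the
associated quadratic form. -/
theorem sq_norm_entry_le_sum_sqNorm {r : ℕ} {A : Matrix (Fin r) (Fin r) ℂ} (hA : A.IsHermitian)
    (i j : Fin r) : ‖A i j‖ ^ 2 ≤ 2 * ∑ a, sqNorm A (polVec a) ^ 2 := by
  by_cases hij : i = j
  · subst hij
    have h1 : ‖A i i‖ ^ 2 = sqNorm A (polVec (i, i, 0)) ^ 2 := by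
      have him : (A i i).im = 0 := by
        have := congrArg Complex.im (hA.apply i i)
        simp only [Complex.star_def, Complex.conj_im] at this
        linarith
      rw [polVec, sqNorm_single_add_smul_single, ← Complex.normSq_eq_norm_sq,
        Complex.normSq_apply]
      simp [him]; ring
    have h2 := Finset.single_le_sum (f := fun a => sqNorm A (polVec a) ^ 2)
      (fun a _ => sq_nonneg _) (Finset.mem_univ (i, i, (0 : Fin 3)))
    have h3 : 0 ≤ sqNorm A (polVec (i, i, 0)) ^ 2 := sq_nonneg _
    linarith
  · let s : Finset (Fin r × Fin r × Fin 3) := {(i, j, 0), (j, i, 0), (i, j, 1), (i, j, 2)}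
    have hs : ∑ a ∈ s, sqNorm A (polVec a) ^ 2 ≤ ∑ a, sqNorm A (polVec a) ^ 2 :=
      Finset.sum_le_sum_of_subset_of_nonneg (Finset.subset_univ s) fun a _ _ => sq_nonneg _
    have hs' : ∑ a ∈ s, sqNorm A (polVec a) ^ 2 = sqNorm A (polVec (i, j, 0)) ^ 2 +
        (sqNorm A (polVec (j, i, 0)) ^ 2 + (sqNorm A (polVec (i, j, 1)) ^ 2 +
          sqNorm A (polVec (i, j, 2)) ^ 2)) := by
      have hij' : j ≠ i := fun h => hij h.symm
      simp only [s]
      rw [Finset.sum_insert, Finset.sum_insert, Finset.sum_insert, Finset.sum_singleton] <;>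
        simp [hij, hij']
    have hji : A j i = (starRingEnd ℂ) (A i j) := (hA.apply j i).symm
    rw [hs'] at hs
    refine le_trans ?_ (mul_le_mul_of_nonneg_left hs zero_le_two)
    simp only [polVec, sqNorm_single_add_smul_single, hji]
    rw [← Complex.normSq_eq_norm_sq, Complex.normSq_apply]
    simp
    nlinarith [sq_nonneg ((A i i).re + (A j j).re + (A i j).re),
      sq_nonneg ((A i i).re + (A j j).re - (A i j).im),
      sq_nonneg ((A i i).re + (A j j).re), sq_nonneg ((A i i).re - (A j j).re),
      sq_nonneg (A i j).re, sq_nonneg (A i j).im]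

/-- The determinant is Lipschitz on bounded sets of matrices. -/
theorem exists_sq_norm_det_sub_le_entries (r : ℕ) (B : ℝ) :
    ∃ C : ℝ, 0 ≤ C ∧ ∀ A A' : Matrix (Fin r) (Fin r) ℂ, (∀ i j, ‖A i j‖ ≤ B) →
      (∀ i j, ‖A' i j‖ ≤ B) → ‖A.det - A'.det‖ ^ 2 ≤ C * ∑ i, ∑ j, ‖A i j - A' i j‖ ^ 2 := by
  let d : (Fin r × Fin r → ℂ) → ℂ := fun x => (Matrix.of fun i j => x (i, j)).det
  have hd : ContDiff ℝ 1 d := by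
    simp only [d, Matrix.det_apply]
    refine ContDiff.sum fun σ _ => ContDiff.const_smul _ (contDiff_prod fun i _ => ?_)
    exact contDiff_apply ℝ ℂ (σ i, i)
  obtain ⟨C, hC⟩ := hd.contDiffOn.exists_lipschitzOnWith one_ne_zero
    (convex_closedBall (0 : Fin r × Fin r → ℂ) B) (isCompact_closedBall _ _)
  refine ⟨(C : ℝ) ^ 2, sq_nonneg _, fun A A' hA hA' => ?_⟩
  rcases lt_or_ge B 0 with hB | hB
  · rcases isEmpty_or_nonempty (Fin r) with he | ⟨⟨i⟩⟩
    · simp [Matrix.det_isEmpty]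
    · exact absurd ((norm_nonneg _).trans (hA i i)) (not_le.2 hB)
  have hmem : ∀ A : Matrix (Fin r) (Fin r) ℂ, (∀ i j, ‖A i j‖ ≤ B) →
      (fun p : Fin r × Fin r => A p.1 p.2) ∈ closedBall (0 : Fin r × Fin r → ℂ) B := fun A hA =>
    mem_closedBall_zero_iff.2 ((pi_norm_le_iff_of_nonneg hB).2 fun p => hA p.1 p.2)
  have h1 := hC.dist_le_mul _ (hmem A hA) _ (hmem A' hA')
  rw [dist_eq_norm, dist_eq_norm] at h1
  have h2 : ‖(fun p : Fin r × Fin r => A p.1 p.2) - fun p => A' p.1 p.2‖ ^ 2 ≤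
      ∑ i, ∑ j, ‖A i j - A' i j‖ ^ 2 := by
    rw [← Fintype.sum_prod_type (fun p : Fin r × Fin r => ‖A p.1 p.2 - A' p.1 p.2‖ ^ 2)]
    refine (Real.le_sqrt (norm_nonneg _) (by positivity)).1 ?_
    refine (pi_norm_le_iff_of_nonneg (Real.sqrt_nonneg _)).2 fun p => ?_
    refine Real.le_sqrt_of_sq_le ?_
    exact Finset.single_le_sum (f := fun p : Fin r × Fin r => ‖A p.1 p.2 - A' p.1 p.2‖ ^ 2)
      (fun _ _ => sq_nonneg _) (Finset.mem_univ p)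
  calc ‖A.det - A'.det‖ ^ 2 ≤ (C * ‖(fun p : Fin r × Fin r => A p.1 p.2) -
        fun p => A' p.1 p.2‖) ^ 2 := pow_le_pow_left₀ (norm_nonneg _) h1 2
    _ ≤ _ := by rw [mul_pow]; exact mul_le_mul_of_nonneg_left h2 (sq_nonneg _)

theorem exists_sq_norm_det_sub_le (r : ℕ) (B : ℝ) :
    ∃ C : ℝ, 0 ≤ C ∧ ∀ A A' : Matrix (Fin r) (Fin r) ℂ, A.PosSemidef → A'.PosSemidef →
      (∀ a, sqNorm A (polVec a) ≤ B) → (∀ a, sqNorm A' (polVec a) ≤ B) →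
      ‖A.det - A'.det‖ ^ 2 ≤ C * ∑ a, (sqNorm A (polVec a) - sqNorm A' (polVec a)) ^ 2 := by
  let N : ℝ := 2 * ∑ _a : Fin r × Fin r × Fin 3, B ^ 2
  obtain ⟨C, hC0, hC⟩ := exists_sq_norm_det_sub_le_entries r (Real.sqrt N)
  have hent : ∀ A : Matrix (Fin r) (Fin r) ℂ, A.PosSemidef → (∀ a, sqNorm A (polVec a) ≤ B) →
      ∀ i j, ‖A i j‖ ≤ Real.sqrt N := fun A hA hB i j => by
    refine Real.le_sqrt_of_sq_le ((sq_norm_entry_le_sum_sqNorm hA.1 i j).trans ?_)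
    refine mul_le_mul_of_nonneg_left (Finset.sum_le_sum fun a _ => ?_) zero_le_two
    exact pow_le_pow_left₀ (sqNorm_nonneg hA _) (hB a) 2
  refine ⟨C * ∑ _i : Fin r, ∑ _j : Fin r, 2, by positivity, fun A A' hA hA' hB hB' => ?_⟩
  refine (hC A A' (hent A hA hB) (hent A' hA' hB')).trans ?_
  rw [mul_assoc, Finset.sum_mul]
  refine mul_le_mul_of_nonneg_left (Finset.sum_le_sum fun i _ => ?_) hC0
  rw [Finset.sum_mul]
  refine Finset.sum_le_sum fun j _ => ?_
  simp_rw [← sqNorm_sub]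
  exact sq_norm_entry_le_sum_sqNorm (hA.1.sub hA'.1) i j

theorem exists_norm_det_le (r : ℕ) (B : ℝ) :
    ∃ C : ℝ, 0 ≤ C ∧ ∀ A : Matrix (Fin r) (Fin r) ℂ, A.PosSemidef →
      (∀ a, sqNorm A (polVec a) ≤ B) → ‖A.det‖ ≤ C := by
  obtain ⟨C, hC0, hC⟩ := exists_sq_norm_det_sub_le r B
  let N : ℝ := C * ∑ _a : Fin r × Fin r × Fin 3, B ^ 2
  refine ⟨Real.sqrt N + ‖(0 : Matrix (Fin r) (Fin r) ℂ).det‖, by positivity, fun A hA hB => ?_⟩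
  have h0 : ∀ v : Fin r → ℂ, sqNorm 0 v = 0 := fun v => by simp [sqNorm]
  have h1 := hC A 0 hA Matrix.PosSemidef.zero hB fun a => by
    rw [h0]; exact (sqNorm_nonneg hA _).trans (hB a)
  have h2 : ‖A.det - (0 : Matrix (Fin r) (Fin r) ℂ).det‖ ≤ Real.sqrt N := by
    refine Real.le_sqrt_of_sq_le (h1.trans ?_)
    refine mul_le_mul_of_nonneg_left (Finset.sum_le_sum fun a _ => ?_) hC0
    rw [h0, sub_zero]
    exact pow_le_pow_left₀ (sqNorm_nonneg hA _) (hB a) 2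
  linarith [norm_le_norm_sub_add A.det (0 : Matrix (Fin r) (Fin r) ℂ).det]

/-- Smooth cutoff functions between a compact set and an open neighbourhood. -/
theorem exists_cutoff {n : ℕ} {K V : Set (Cn n)} (hK : IsCompact K) (hV : IsOpen V)
    (hKV : K ⊆ V) :
    ∃ χ : Cn n → ℝ, ContDiff ℝ (⊤ : ℕ∞) χ ∧ HasCompactSupport χ ∧ tsupport χ ⊆ V ∧
      (∀ z, 0 ≤ χ z) ∧ (∀ z, χ z ≤ 1) ∧ ∀ z ∈ K, χ z = 1 := by
  obtain ⟨δ, hδ, hδV⟩ := hK.exists_cthickening_subset_open hV hKV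
  have hc : IsCompact (cthickening δ K) := hK.cthickening
  have hdisj : Disjoint (thickening δ K)ᶜ K :=
    Set.disjoint_left.2 fun z hz hzK => hz (self_subset_thickening hδ K hzK)
  obtain ⟨χ, hχ0, hχ1, hχ⟩ := exists_contMDiffMap_zero_one_of_isClosed (n := (⊤ : ℕ∞))
    (modelWithCornersSelf ℝ (Cn n)) isOpen_thickening.isClosed_compl hK.isClosed hdisj
  have hsupp : Function.support χ ⊆ thickening δ K := fun z hz => by
    by_contra h
    exact hz (hχ0 h)
  have hts : tsupport χ ⊆ cthickening δ K :=
    (closure_mono hsupp).trans (closure_thickening_subset_cthickening δ K)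
  exact ⟨χ, χ.contMDiff.contDiff, hc.of_isClosed_subset (isClosed_tsupport _) hts, hts.trans hδV,
    fun z => (hχ z).1, fun z => (hχ z).2, fun z hz => hχ1 hz⟩

/-- A measurable field of semi-positive Hermitian forms with plurisubharmonic norms of constant
sections. -/
structure WeakSemiNegOn {n r : ℕ} (U : Set (Cn n)) (h : Cn n → Matrix (Fin r) (Fin r) ℂ) :
    Prop where
  measurable : ∀ a b, Measurable fun z => h z a b
  posSemidef : ∀ z ∈ U, (h z).PosSemidef
  psh : ∀ v, PshOnR (fun z => sqNorm (h z) v) U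

theorem WeakSemiNegOn.measurable_sqNorm {n r : ℕ} {U : Set (Cn n)}
    {h : Cn n → Matrix (Fin r) (Fin r) ℂ} (hh : WeakSemiNegOn U h) (v : Fin r → ℂ) :
    Measurable fun z => sqNorm (h z) v := by
  simp only [sqNorm, dotProduct, Matrix.mulVec]
  refine Complex.measurable_re.comp (Finset.measurable_sum _ fun i _ => measurable_const.mul
    (Finset.measurable_sum _ fun j _ => (hh.measurable i j).mul measurable_const))

theorem WeakSemiNegOn.measurable_det {n r : ℕ} {U : Set (Cn n)}
    {h : Cn n → Matrix (Fin r) (Fin r) ℂ} (hh : WeakSemiNegOn U h) :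
    Measurable fun z => (h z).det := by
  simp only [Matrix.det_apply]
  exact Finset.measurable_sum _ fun σ _ => (Finset.measurable_prod _ fun i _ =>
    hh.measurable (σ i) i).const_smul _

/-- Uniform `L²` estimate for differences of `det h` over small circles: the constant depends on
`h` only through a bound of its quadratic form on a compact neighbourhood. -/
theorem exists_lintegral_sq_det_circleShift_sub_le {n : ℕ} (r : ℕ) {U K : Set (Cn n)}
    (hU : IsOpen U) (hK : IsCompact K) (hKU : K ⊆ U) (m : Fin n) :
    ∃ L : Set (Cn n), IsCompact L ∧ L ⊆ U ∧ K ⊆ L ∧ ∃ ε₀ : ℝ, 0 < ε₀ ∧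
      (∀ z ∈ K, ∀ v, ‖v‖ ≤ ε₀ → z + v ∈ L) ∧
      ∀ B : ℝ, ∃ C : ℝ, ∀ h : Cn n → Matrix (Fin r) (Fin r) ℂ, WeakSemiNegOn U h →
        (∀ a, ∀ z ∈ L, sqNorm (h z) (polVec a) ≤ B) → ∀ ε, 0 < ε → ε ≤ ε₀ →
        ∫⁻ z in K, ∫⁻ θ, ‖(h (z + circleShift m ε θ)).det - (h z).det‖ₑ ^ 2 ∂circleHaar ≤
          ENNReal.ofReal (C * ε ^ 2) := by
  obtain ⟨δ, hδ, hδU⟩ := hK.exists_cthickening_subset_open hU hKU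
  have hLc : IsCompact (cthickening δ K) := hK.cthickening
  have hadd : ∀ z ∈ cthickening (δ / 2) K, ∀ v, ‖v‖ ≤ δ / 2 → z + v ∈ cthickening δ K := by
    intro z hz v hv
    have h1 : z + v ∈ cthickening (δ / 2) (cthickening (δ / 2) K) :=
      mem_cthickening_of_dist_le _ z _ _ hz (by simpa [dist_eq_norm] using hv)
    have h2 := cthickening_cthickening_subset (half_pos hδ).le (half_pos hδ).le K h1
    rwa [add_halves] at h2
  obtain ⟨χ, hχ, hχc, hχs, hχ0, hχ1, hχK⟩ := exists_cutoff hK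
    (isOpen_thickening (δ := δ / 2)) (self_subset_thickening (half_pos hδ) K)
  obtain ⟨Cχ, hCχ0, hCχ⟩ := exists_abs_integral_circleShift_sub_le m hχ hχc
  refine ⟨cthickening δ K, hLc, hδU, self_subset_cthickening K, δ / 2, half_pos hδ,
    fun z hz => hadd z (self_subset_cthickening K hz), fun B => ?_⟩
  set L := cthickening δ K with hL
  obtain ⟨Cd, hCd0, hCd⟩ := exists_sq_norm_det_sub_le r B
  refine ⟨Cd * ∑ _a : Fin r × Fin r × Fin 3, B ^ 2 * Cχ * volume.real L,
    fun h hh hB ε hε hε₀ => ?_⟩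
  have hLε : ∀ z ∈ tsupport χ, ∀ w : ℂ, ‖w‖ ≤ ε → z + w • basisV m ∈ L := fun z hz w hw =>
    hadd z (thickening_subset_cthickening _ _ (hχs hz)) _ <| by
      rw [norm_smul]
      exact (mul_le_of_le_one_right (norm_nonneg _) (norm_basisV_le m)).trans (hw.trans hε₀)
  have hcacc := fun a => (hh.psh (polVec a)).integral_circle_sq_sub_le
    (hh.measurable_sqNorm _) m hLc hδU (fun z hz => sqNorm_nonneg (hh.posSemidef z (hδU hz)) _)
    (hB a) hχ.continuous hχ0 hχ1 hε (hCχ ε hε.le) hLε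
  set q : Fin r × Fin r × Fin 3 → Cn n → ℝ := fun a =>
    L.indicator fun z => sqNorm (h z) (polVec a) with hq
  let Φ : Cn n × UnitAddCircle → ℝ := fun p =>
    Cd * ∑ a, χ p.1 * (q a (p.1 + circleShift m ε p.2) - q a p.1) ^ 2
  have hΦi : Integrable Φ (volume.prod circleHaar) :=
    (integrable_finsetSum _ fun a _ => (hcacc a).1).const_mul _
  have hΦ0 : ∀ p, 0 ≤ Φ p := fun p => mul_nonneg hCd0
    (Finset.sum_nonneg fun a _ => mul_nonneg (hχ0 _) (sq_nonneg _))
  have hpt : ∀ z ∈ K, ∀ θ, ‖(h (z + circleShift m ε θ)).det - (h z).det‖ₑ ^ 2 ≤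
      ENNReal.ofReal (Φ (z, θ)) := by
    intro z hz θ
    have hzL : z ∈ L := self_subset_cthickening K hz
    have hzL' : z + circleShift m ε θ ∈ L := hadd z (self_subset_cthickening K hz) _
      ((norm_circleShift_le m hε.le θ).trans hε₀)
    rw [← ofReal_norm, ← ENNReal.ofReal_pow (norm_nonneg _)]
    refine ENNReal.ofReal_le_ofReal ?_
    refine (hCd _ _ (hh.posSemidef _ (hδU hzL')) (hh.posSemidef _ (hδU hzL))
      (fun a => hB a _ hzL') (fun a => hB a _ hzL)).trans (le_of_eq ?_)
    simp [Φ, hq, hχK z hz, Set.indicator_of_mem hzL, Set.indicator_of_mem hzL']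
  calc ∫⁻ z in K, ∫⁻ θ, ‖(h (z + circleShift m ε θ)).det - (h z).det‖ₑ ^ 2 ∂circleHaar
      ≤ ∫⁻ z in K, ∫⁻ θ, ENNReal.ofReal (Φ (z, θ)) ∂circleHaar :=
        setLIntegral_mono' hK.measurableSet fun z hz => lintegral_mono (hpt z hz)
    _ ≤ ∫⁻ z, ∫⁻ θ, ENNReal.ofReal (Φ (z, θ)) ∂circleHaar := setLIntegral_le_lintegral _ _
    _ = ∫⁻ p, ENNReal.ofReal (Φ p) ∂(volume.prod circleHaar) :=
        (lintegral_prod _ hΦi.aestronglyMeasurable.aemeasurable.ennreal_ofReal).symm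
    _ = ENNReal.ofReal (∫ p, Φ p ∂(volume.prod circleHaar)) :=
        (ofReal_integral_eq_lintegral_ofReal hΦi (Eventually.of_forall hΦ0)).symm
    _ ≤ _ := by
        refine ENNReal.ofReal_le_ofReal ?_
        simp only [Φ]
        rw [integral_const_mul, integral_finsetSum _ fun a _ => (hcacc a).1, mul_assoc,
          Finset.sum_mul]
        refine mul_le_mul_of_nonneg_left (Finset.sum_le_sum fun a _ => ?_) hCd0
        rw [integral_prod _ (hcacc a).1]
        exact (hcacc a).2.trans (le_of_eq (by ring))

/-- Difference quotient approximating the Wirtinger derivative `∂/∂z_m` by averages over circles. -/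
def circDiff {n : ℕ} (m : Fin n) (ε : ℝ) (g : Cn n → ℂ) (z : Cn n) : ℂ :=
  (ε : ℂ)⁻¹ * ∫ θ, (starRingEnd ℂ) (circlePt θ) * g (z + circleShift m ε θ) ∂circleHaar

theorem integrable_circleHaar_of_continuous {E : Type*} [NormedAddCommGroup E]
    {g : UnitAddCircle → E} (hg : Continuous g) : Integrable g circleHaar :=
  hg.integrable_of_hasCompactSupport (HasCompactSupport.of_compactSpace g)

theorem fderiv_smul_basisV {n : ℕ} (m : Fin n) (g : Cn n → ℂ) (z : Cn n) (w : ℂ) :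
    fderiv ℝ g z (w • basisV m) = wder m g z * w + wbar m g z * (starRingEnd ℂ) w := by
  have h1 : w • basisV m = w.re • (basisV m : Cn n) + w.im • (Complex.I • (basisV m : Cn n)) := by
    ext k
    simp only [Pi.smul_apply, Pi.add_apply, smul_eq_mul, Complex.real_smul]
    rw [← mul_assoc, ← add_mul, Complex.re_add_im]
  rw [h1, map_add, map_smul, map_smul, wder, wbar, Complex.real_smul, Complex.real_smul]
  have h2 : (starRingEnd ℂ) w = w.re - w.im * Complex.I := by
    apply Complex.ext <;> simp
  rw [h2]
  linear_combination (w.im : ℂ) * fderiv ℝ g z (Complex.I • basisV m) * Complex.I_sq +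
    (1 / 2 : ℂ) * (fderiv ℝ g z (basisV m) - Complex.I * fderiv ℝ g z (Complex.I • basisV m)) *
      Complex.re_add_im w

theorem integral_conj_circlePt_mul_fderiv {n : ℕ} (m : Fin n) (ε : ℝ) (g : Cn n → ℂ) (z : Cn n) :
    ∫ θ, (starRingEnd ℂ) (circlePt θ) * fderiv ℝ g z (circleShift m ε θ) ∂circleHaar =
      ε * wder m g z := by
  have hc : Continuous fun θ => (starRingEnd ℂ) (circlePt θ) :=
    Complex.continuous_conj.comp continuous_circlePt
  have h1 : ∀ θ, (starRingEnd ℂ) (circlePt θ) * fderiv ℝ g z (circleShift m ε θ) =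
      ε * wder m g z + ε * wbar m g z * ((starRingEnd ℂ) (circlePt θ) *
        (starRingEnd ℂ) (circlePt θ)) := by
    intro θ
    have h2 : (starRingEnd ℂ) (circlePt θ) * circlePt θ = 1 := by
      rw [← Complex.normSq_eq_conj_mul_self, Complex.normSq_eq_norm_sq, norm_circlePt]; simp
    rw [circleShift, fderiv_smul_basisV, map_mul, Complex.conj_ofReal]
    linear_combination (ε * wder m g z : ℂ) * h2
  simp_rw [h1]
  have h3 : Integrable (fun θ => (starRingEnd ℂ) (circlePt θ) * (starRingEnd ℂ) (circlePt θ))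
      circleHaar := integrable_circleHaar_of_continuous (hc.mul hc)
  rw [integral_add (integrable_const _) (h3.const_mul _), integral_const_mul (ε * wbar m g z : ℂ),
    integral_conj_circlePt_sq]
  simp

theorem integrable_conj_circlePt_mul {F : UnitAddCircle → ℂ} (hF : Integrable F circleHaar) :
    Integrable (fun θ => (starRingEnd ℂ) (circlePt θ) * F θ) circleHaar :=
  hF.bdd_mul (c := 1) (Complex.continuous_conj.comp continuous_circlePt).aestronglyMeasurable
    (Eventually.of_forall fun θ => by simp [norm_circlePt])

theorem circDiff_eq_integral_sub {n : ℕ} (m : Fin n) (ε : ℝ) {g : Cn n → ℂ} {z : Cn n}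
    (hg : Integrable (fun θ => g (z + circleShift m ε θ)) circleHaar) (c : ℂ) :
    circDiff m ε g z = (ε : ℂ)⁻¹ *
      ∫ θ, (starRingEnd ℂ) (circlePt θ) * (g (z + circleShift m ε θ) - c) ∂circleHaar := by
  simp_rw [mul_sub]
  rw [circDiff, integral_sub (integrable_conj_circlePt_mul hg)
    (integrable_conj_circlePt_mul (integrable_const c)), integral_mul_const,
    integral_conj_circlePt, zero_mul, sub_zero]

theorem norm_circDiff_sub_wder_le {n : ℕ} (m : Fin n) {ε δ : ℝ} (hε : 0 < ε) {g : Cn n → ℂ}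
    {z : Cn n} (hg : Integrable (fun θ => g (z + circleShift m ε θ)) circleHaar)
    (hδ : ∀ θ, ‖g (z + circleShift m ε θ) - g z - fderiv ℝ g z (circleShift m ε θ)‖ ≤ δ * ε) :
    ‖circDiff m ε g z - wder m g z‖ ≤ δ := by
  have hε' : (ε : ℂ) ≠ 0 := by exact_mod_cast hε.ne'
  have hL : Integrable (fun θ => fderiv ℝ g z (circleShift m ε θ)) circleHaar :=
    integrable_circleHaar_of_continuous
      ((fderiv ℝ g z).continuous.comp (continuous_circleShift m ε))
  have hgs : Integrable (fun θ => g (z + circleShift m ε θ) - g z) circleHaar :=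
    hg.sub (integrable_const _)
  have h1 : circDiff m ε g z - wder m g z = (ε : ℂ)⁻¹ *
      ∫ θ, (starRingEnd ℂ) (circlePt θ) * (g (z + circleShift m ε θ) - g z -
        fderiv ℝ g z (circleShift m ε θ)) ∂circleHaar := by
    simp_rw [mul_sub _ _ (fderiv ℝ g z _)]
    rw [integral_sub (integrable_conj_circlePt_mul hgs)
      (integrable_conj_circlePt_mul hL), integral_conj_circlePt_mul_fderiv, mul_sub,
      ← circDiff_eq_integral_sub m ε hg, inv_mul_cancel_left₀ hε']
  rw [h1, norm_mul, norm_inv, Complex.norm_real, Real.norm_eq_abs, abs_of_pos hε,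
    inv_mul_le_iff₀ hε, mul_comm ε]
  refine (norm_integral_le_of_norm_le_const (C := δ * ε)
    (Eventually.of_forall fun θ => ?_)).trans (by simp)
  simpa [norm_circlePt] using hδ θ

theorem tendsto_circDiff {n : ℕ} (m : Fin n) {g : Cn n → ℂ} {z : Cn n}
    (hd : DifferentiableAt ℝ g z)
    (hg : ∀ᶠ ε in 𝓝[>] (0 : ℝ), Integrable (fun θ => g (z + circleShift m ε θ)) circleHaar) :
    Tendsto (fun ε => circDiff m ε g z) (𝓝[>] 0) (𝓝 (wder m g z)) := by
  rw [Metric.tendsto_nhds]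
  intro δ hδ
  have h1 := hd.hasFDerivAt.isLittleO.def (half_pos hδ)
  obtain ⟨ρ, hρ, hball⟩ := Metric.eventually_nhds_iff.1 h1
  filter_upwards [hg, Ioo_mem_nhdsGT hρ] with ε hint hε
  rw [dist_eq_norm]
  refine (norm_circDiff_sub_wder_le m hε.1 hint (δ := δ / 2) fun θ => ?_).trans_lt
    (half_lt_self hδ)
  have h2 := norm_circleShift_le m hε.1.le θ
  have h3 := hball (y := z + circleShift m ε θ) (by simpa [dist_eq_norm] using h2.trans_lt hε.2)
  rw [add_sub_cancel_left] at h3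
  exact h3.trans (by gcongr)

theorem enorm_integral_sq_le {α : Type*} [MeasurableSpace α] {μ : Measure α}
    [IsProbabilityMeasure μ] {F : α → ℂ} (hF : AEStronglyMeasurable F μ) :
    ‖∫ x, F x ∂μ‖ₑ ^ 2 ≤ ∫⁻ x, ‖F x‖ₑ ^ 2 ∂μ := by
  have h1 := (enorm_integral_le_lintegral_enorm F (μ := μ))
  have h2 := eLpNorm_le_eLpNorm_of_exponent_le (p := 1) (q := 2) one_le_two hF
  rw [eLpNorm_one_eq_lintegral_enorm] at h2
  have h3 := eLpNorm_nnreal_pow_eq_lintegral (f := F) (μ := μ) (p := 2) two_ne_zero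
  calc _ ≤ (eLpNorm F 2 μ) ^ 2 := by gcongr; exact h1.trans h2
    _ = _ := by simpa using h3

theorem enorm_circDiff_sq_le {n : ℕ} (m : Fin n) {ε : ℝ} (hε : 0 < ε) {g : Cn n → ℂ}
    {z : Cn n} (hg : Integrable (fun θ => g (z + circleShift m ε θ)) circleHaar) :
    ‖circDiff m ε g z‖ₑ ^ 2 ≤ ENNReal.ofReal (ε⁻¹ ^ 2) *
      ∫⁻ θ, ‖g (z + circleShift m ε θ) - g z‖ₑ ^ 2 ∂circleHaar := by
  rw [circDiff_eq_integral_sub m ε hg (g z), enorm_mul, mul_pow]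
  gcongr
  · rw [← ofReal_norm, ← ENNReal.ofReal_pow (norm_nonneg _), norm_inv, Complex.norm_real,
      Real.norm_eq_abs, abs_of_pos hε]
  · refine (enorm_integral_sq_le (integrable_conj_circlePt_mul
      (hg.sub (integrable_const _))).aestronglyMeasurable).trans (le_of_eq ?_)
    refine lintegral_congr fun θ => ?_
    rw [enorm_mul, ← ofReal_norm, RCLike.norm_conj, norm_circlePt, ENNReal.ofReal_one, one_mul,
      Pi.sub_apply]

theorem lintegral_enorm_mul_le {α : Type*} [MeasurableSpace α] {μ : Measure α} {f g : α → ℂ}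
    (hf : AEMeasurable f μ) (hg : AEMeasurable g μ) :
    ∫⁻ x, ‖f x * g x‖ₑ ∂μ ≤ (∫⁻ x, ‖f x‖ₑ ^ 2 ∂μ) ^ (1 / 2 : ℝ) *
      (∫⁻ x, ‖g x‖ₑ ^ 2 ∂μ) ^ (1 / 2 : ℝ) := by
  have := ENNReal.lintegral_mul_le_Lp_mul_Lq μ Real.HolderConjugate.two_two hf.enorm hg.enorm
  simpa [enorm_mul] using this

/-- Bounded measurable functions with compact support. -/
structure BddMeasOn {n : ℕ} (L : Set (Cn n)) (B : ℝ) (g : Cn n → ℂ) : Prop where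
  measurable : Measurable g
  bound : ∀ z, ‖g z‖ ≤ B
  eq_zero : ∀ z ∉ L, g z = 0

theorem BddMeasOn.indicator {n : ℕ} {L : Set (Cn n)} (hL : MeasurableSet L) {B : ℝ} (hB0 : 0 ≤ B)
    {g : Cn n → ℂ} (hg : Measurable g) (hB : ∀ z ∈ L, ‖g z‖ ≤ B) :
    BddMeasOn L B (L.indicator g) where
  measurable := hg.indicator hL
  bound z := by
    by_cases hz : z ∈ L
    · simpa [hz] using hB z hz
    · simpa [hz] using hB0
  eq_zero z hz := Set.indicator_of_notMem hz g

theorem measurable_comp_add_circleShift {n : ℕ} (m : Fin n) (ε : ℝ) {g : Cn n → ℂ}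
    (hg : Measurable g) :
    Measurable fun p : Cn n × UnitAddCircle => g (p.1 + circleShift m ε p.2) :=
  hg.comp (measurable_fst.add ((continuous_circleShift m ε).measurable.comp measurable_snd))

theorem BddMeasOn.integrable_circleShift {n : ℕ} {L : Set (Cn n)} {B : ℝ} {g : Cn n → ℂ}
    (hg : BddMeasOn L B g) (m : Fin n) (ε : ℝ) (z : Cn n) :
    Integrable (fun θ => g (z + circleShift m ε θ)) circleHaar :=
  integrable_of_bounded_of_eq_zero (S := Set.univ) (measure_ne_top _ _)
    ((measurable_comp_add_circleShift m ε hg.measurable).comp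
      measurable_prodMk_left).aestronglyMeasurable
    (fun _ _ => hg.bound _) (by simp)

theorem measurable_circDiff {n : ℕ} (m : Fin n) (ε : ℝ) {g : Cn n → ℂ} (hg : Measurable g) :
    Measurable (circDiff m ε g) := by
  refine Measurable.const_mul (StronglyMeasurable.measurable ?_) _
  refine StronglyMeasurable.integral_prod_right' (f := fun p : Cn n × UnitAddCircle =>
    (starRingEnd ℂ) (circlePt p.2) * g (p.1 + circleShift m ε p.2)) ?_
  exact (((Complex.continuous_conj.comp continuous_circlePt).measurable.comp measurable_snd).mul
    (measurable_comp_add_circleShift m ε hg)).stronglyMeasurable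

theorem integral_mul_circDiff {n : ℕ} {L : Set (Cn n)} (hL : volume L ≠ ⊤) {B : ℝ} {g : Cn n → ℂ}
    (hg : BddMeasOn L B g) (m : Fin n) (ε : ℝ) {φ : Cn n → ℂ} (hφ : Continuous φ)
    (hφc : HasCompactSupport φ) :
    ∫ z, g z * circDiff m ε φ z = -∫ z, circDiff m ε g z * φ z := by
  obtain ⟨Bφ, hBφ⟩ := hφ.bounded_above_of_compact_support hφc
  set c : UnitAddCircle → ℂ := fun θ => (starRingEnd ℂ) (circlePt θ) with hc
  have hcc : Continuous c := Complex.continuous_conj.comp continuous_circlePt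
  have hcn : ∀ θ, ‖c θ‖ = 1 := fun θ => by simp [hc, norm_circlePt]
  have hneg : ∀ θ, c (θ + ((1 / 2 : ℝ) : UnitAddCircle)) = -c θ := fun θ => by
    simp only [hc]; rw [circlePt_add_half, map_neg]
  have hKφ : volume (tsupport φ) ≠ ⊤ := hφc.isCompact.measure_lt_top.ne
  have hφm := hφ.measurable
  have hcm : Measurable fun p : Cn n × UnitAddCircle => c p.2 := hcc.measurable.comp measurable_snd
  have hB0 : 0 ≤ B := (norm_nonneg _).trans (hg.bound 0)
  have hBφ0 : 0 ≤ Bφ := (norm_nonneg _).trans (hBφ 0)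
  have hi1 : Integrable (fun p : Cn n × UnitAddCircle =>
      g p.1 * (c p.2 * φ (p.1 + circleShift m ε p.2))) (volume.prod circleHaar) := by
    refine integrable_of_bounded_of_eq_zero (S := L ×ˢ Set.univ) (B := B * Bφ) ?_ ?_ ?_ ?_
    · rw [Measure.prod_prod]; exact ENNReal.mul_ne_top hL (measure_ne_top _ _)
    · exact ((hg.measurable.comp measurable_fst).mul
        (hcm.mul (measurable_comp_add_circleShift m ε hφm))).aestronglyMeasurable
    · intro p _
      rw [norm_mul, norm_mul, hcn, one_mul]
      exact mul_le_mul (hg.bound _) (hBφ _) (norm_nonneg _) hB0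
    · intro p hp
      rw [hg.eq_zero p.1 (fun h => hp ⟨h, trivial⟩), zero_mul]
  have hi2 : Integrable (fun p : Cn n × UnitAddCircle =>
      c p.2 * g (p.1 + circleShift m ε p.2) * φ p.1) (volume.prod circleHaar) := by
    refine integrable_of_bounded_of_eq_zero (S := tsupport φ ×ˢ Set.univ) (B := B * Bφ) ?_ ?_ ?_ ?_
    · rw [Measure.prod_prod]; exact ENNReal.mul_ne_top hKφ (measure_ne_top _ _)
    · exact ((hcm.mul (measurable_comp_add_circleShift m ε hg.measurable)).mul
        (hφm.comp measurable_fst)).aestronglyMeasurable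
    · intro p _
      rw [norm_mul, norm_mul, hcn, one_mul]
      exact mul_le_mul (hg.bound _) (hBφ _) (norm_nonneg _) hB0
    · intro p hp
      rw [image_eq_zero_of_notMem_tsupport (fun h => hp ⟨h, trivial⟩), mul_zero]
  have h1 : ∫ z, g z * circDiff m ε φ z = (ε : ℂ)⁻¹ *
      ∫ θ, (∫ z, g z * (c θ * φ (z + circleShift m ε θ))) ∂circleHaar := by
    rw [← integral_integral_swap hi1, ← integral_const_mul]
    refine integral_congr_ae (Eventually.of_forall fun z => ?_)
    simp only [circDiff]
    rw [integral_const_mul]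
    ring
  have h2 : ∫ z, circDiff m ε g z * φ z = (ε : ℂ)⁻¹ *
      ∫ θ, (∫ z, c θ * g (z + circleShift m ε θ) * φ z) ∂circleHaar := by
    rw [← integral_integral_swap hi2, ← integral_const_mul]
    refine integral_congr_ae (Eventually.of_forall fun z => ?_)
    simp only [circDiff]
    rw [integral_mul_const]
    ring
  rw [h1, h2, ← mul_neg, ← integral_neg,
    ← integral_add_right_eq_self _ ((1 / 2 : ℝ) : UnitAddCircle)]
  congr 1
  refine integral_congr_ae (Eventually.of_forall fun θ => ?_)
  simp only [hneg, circleShift_add_half]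
  rw [← integral_neg, ← integral_add_right_eq_self _ (circleShift m ε θ)]
  refine integral_congr_ae (Eventually.of_forall fun z => ?_)
  simp only [add_neg_cancel_right]
  ring

theorem continuous_wder {n : ℕ} (m : Fin n) {φ : Cn n → ℂ} (hφ : ContDiff ℝ (⊤ : ℕ∞) φ) :
    Continuous (wder m φ) := by
  have h := hφ.continuous_fderiv (by simp)
  unfold wder
  fun_prop

theorem wder_eq_zero_of_notMem_tsupport {n : ℕ} (m : Fin n) {φ : Cn n → ℂ} {z : Cn n}
    (hz : z ∉ tsupport φ) : wder m φ z = 0 := by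
  have h : fderiv ℝ φ z = 0 := by
    by_contra h
    exact hz (support_fderiv_subset ℝ h)
  simp [wder, h]

theorem hasCompactSupport_wder {n : ℕ} (m : Fin n) {φ : Cn n → ℂ} (hφ : HasCompactSupport φ) :
    HasCompactSupport (wder m φ) :=
  HasCompactSupport.intro hφ.isCompact fun _ hz => wder_eq_zero_of_notMem_tsupport m hz

theorem wder_congr {n : ℕ} (m : Fin n) {f g : Cn n → ℂ} {z : Cn n} (h : f =ᶠ[𝓝 z] g) :
    wder m f z = wder m g z := by
  rw [wder, wder, h.fderiv_eq]

theorem BddMeasOn.integrable_mul {n : ℕ} {L : Set (Cn n)} (hL : volume L ≠ ⊤) {B : ℝ}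
    {g : Cn n → ℂ} (hg : BddMeasOn L B g) {φ : Cn n → ℂ} (hφ : Measurable φ) {C : ℝ}
    (hC : ∀ z, ‖φ z‖ ≤ C) : Integrable fun z => g z * φ z := by
  refine integrable_of_bounded_of_eq_zero hL (B := B * C)
    (hg.measurable.mul hφ).aestronglyMeasurable
    (fun z _ => ?_) fun z hz => by rw [hg.eq_zero z hz, zero_mul]
  rw [norm_mul]
  exact mul_le_mul (hg.bound z) (hC z) (norm_nonneg _) ((norm_nonneg _).trans (hg.bound z))

theorem tendsto_integral_mul_circDiff {n : ℕ} {L : Set (Cn n)} (hL : volume L ≠ ⊤) {B : ℝ}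
    {g : Cn n → ℂ} (hg : BddMeasOn L B g) (m : Fin n) {φ : Cn n → ℂ}
    (hφ : ContDiff ℝ (⊤ : ℕ∞) φ) (hφc : HasCompactSupport φ) :
    Tendsto (fun ε => ∫ z, g z * circDiff m ε φ z) (𝓝[>] 0) (𝓝 (∫ z, g z * wder m φ z)) := by
  obtain ⟨C, hC0, hC⟩ := exists_taylor_bound_of_hasCompactSupport hφ hφc
  obtain ⟨Cw, hCw⟩ := (continuous_wder m hφ).bounded_above_of_compact_support
    (hasCompactSupport_wder m hφc)
  have hφi : ∀ ε z, Integrable (fun θ => φ (z + circleShift m ε θ)) circleHaar := fun ε z =>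
    integrable_circleHaar_of_continuous
      (hφ.continuous.comp (continuous_const.add (continuous_circleShift m ε)))
  have hkey : ∀ ε, 0 < ε → ∀ z, ‖circDiff m ε φ z - wder m φ z‖ ≤ C * ε := fun ε hε z =>
    norm_circDiff_sub_wder_le m hε (hφi ε z) fun θ => (hC z _).trans <| by
      rw [mul_assoc, ← pow_two]
      gcongr
      exact norm_circleShift_le m hε.le θ
  have hmc : ∀ ε, Measurable (circDiff m ε φ) := fun ε =>
    measurable_circDiff m ε hφ.continuous.measurable
  have hmw := (continuous_wder m hφ).measurable
  have hest : ∀ᶠ ε in 𝓝[>] (0 : ℝ), ‖(∫ z, g z * circDiff m ε φ z) - ∫ z, g z * wder m φ z‖ ≤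
      B * (C * ε) * volume.real L := by
    filter_upwards [self_mem_nhdsWithin] with ε hε
    have hε' : 0 < ε := hε
    have hCb : ∀ z, ‖circDiff m ε φ z‖ ≤ C * ε + Cw := fun z => by
      have h1 := norm_add_le (circDiff m ε φ z - wder m φ z) (wder m φ z)
      rw [sub_add_cancel] at h1
      exact h1.trans (add_le_add (hkey ε hε z) (hCw z))
    rw [← integral_sub (hg.integrable_mul hL (hmc ε) hCb) (hg.integrable_mul hL hmw hCw),
      ← setIntegral_eq_integral_of_forall_compl_eq_zero (s := L)
        fun z hz => by rw [hg.eq_zero z hz]; simp]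
    refine norm_setIntegral_le_of_norm_le_const hL.lt_top fun z _ => ?_
    rw [← mul_sub, norm_mul]
    exact mul_le_mul (hg.bound z) (hkey ε hε z) (norm_nonneg _)
      ((norm_nonneg _).trans (hg.bound z))
  rw [tendsto_iff_norm_sub_tendsto_zero]
  refine squeeze_zero' (Eventually.of_forall fun _ => norm_nonneg _) hest ?_
  have : Tendsto (fun ε : ℝ => B * (C * ε) * volume.real L) (𝓝 0)
      (𝓝 (B * (C * 0) * volume.real L)) :=
    (by fun_prop : Continuous fun ε : ℝ => B * (C * ε) * volume.real L).tendsto 0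
  simp only [mul_zero, zero_mul] at this
  exact this.mono_left nhdsWithin_le_nhds

/-- Uniform `L²` bound for the difference quotients of `det h`. -/
theorem exists_lintegral_sq_circDiff_det_le {n : ℕ} (r : ℕ) {U K : Set (Cn n)}
    (hU : IsOpen U) (hK : IsCompact K) (hKU : K ⊆ U) (m : Fin n) :
    ∃ L : Set (Cn n), IsCompact L ∧ L ⊆ U ∧ (∀ z ∈ K, L ∈ 𝓝 z) ∧ ∃ ε₀ : ℝ, 0 < ε₀ ∧
      ∀ B : ℝ, ∃ B' C : ℝ, ∀ h : Cn n → Matrix (Fin r) (Fin r) ℂ, WeakSemiNegOn U h →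
        (∀ a, ∀ z ∈ L, sqNorm (h z) (polVec a) ≤ B) →
        BddMeasOn L B' (L.indicator fun z => (h z).det) ∧
        ∀ ε, 0 < ε → ε ≤ ε₀ →
        ∫⁻ z in K, ‖circDiff m ε (L.indicator fun z => (h z).det) z‖ₑ ^ 2 ≤ ENNReal.ofReal C := by
  obtain ⟨L, hL, hLU, hKL, ε₀, hε₀, hLε, hmain⟩ :=
    exists_lintegral_sq_det_circleShift_sub_le r hU hK hKU m
  refine ⟨L, hL, hLU, fun z hz => ?_, ε₀, hε₀, fun B => ?_⟩
  · filter_upwards [closedBall_mem_nhds z hε₀] with w hw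
    have := hLε z hz (w - z) (by rwa [← dist_eq_norm])
    rwa [add_sub_cancel] at this
  obtain ⟨C, hC⟩ := hmain B
  obtain ⟨B', hB'0, hB'⟩ := exists_norm_det_le r B
  refine ⟨B', C, fun h hh hB => ?_⟩
  have hbdd : BddMeasOn L B' (L.indicator fun z => (h z).det) :=
    BddMeasOn.indicator hL.measurableSet hB'0 hh.measurable_det
      fun z hz => hB' _ (hh.posSemidef z (hLU hz)) fun a => hB a z hz
  refine ⟨hbdd, fun ε hε hεε => ?_⟩
  calc ∫⁻ z in K, ‖circDiff m ε (L.indicator fun z => (h z).det) z‖ₑ ^ 2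
      ≤ ∫⁻ z in K, ENNReal.ofReal (ε⁻¹ ^ 2) *
        ∫⁻ θ, ‖(h (z + circleShift m ε θ)).det - (h z).det‖ₑ ^ 2 ∂circleHaar := by
        refine setLIntegral_mono' hK.measurableSet fun z hz => ?_
        refine (enorm_circDiff_sq_le m hε (hbdd.integrable_circleShift m ε z)).trans (le_of_eq ?_)
        congr 1
        refine lintegral_congr fun θ => ?_
        rw [Set.indicator_of_mem (hKL hz), Set.indicator_of_mem
          (hLε z hz _ ((norm_circleShift_le m hε.le θ).trans hεε))]
    _ = ENNReal.ofReal (ε⁻¹ ^ 2) * ∫⁻ z in K,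
        ∫⁻ θ, ‖(h (z + circleShift m ε θ)).det - (h z).det‖ₑ ^ 2 ∂circleHaar :=
        lintegral_const_mul' _ _ ENNReal.ofReal_ne_top
    _ ≤ ENNReal.ofReal (ε⁻¹ ^ 2) * ENNReal.ofReal (C * ε ^ 2) := by
        gcongr
        exact hC h hh hB ε hε hεε
    _ = ENNReal.ofReal C := by
        rw [← ENNReal.ofReal_mul (by positivity)]
        congr 1
        field_simp

/-- `det h` defines a bounded functional `φ ↦ ∫ det h ∂φ` on test functions in the `L²` norm. -/
theorem WeakSemiNegOn.exists_enorm_integral_det_mul_wder_le {n r : ℕ} {U K : Set (Cn n)}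
    (hU : IsOpen U) (hK : IsCompact K) (hKU : K ⊆ U) (m : Fin n)
    {h : Cn n → Matrix (Fin r) (Fin r) ℂ} (hh : WeakSemiNegOn U h)
    (hbdd : ∀ L, IsCompact L → L ⊆ U → ∃ B, ∀ a, ∀ z ∈ L, sqNorm (h z) (polVec a) ≤ B) :
    ∃ C : ℝ, ∀ φ : Cn n → ℂ, ContDiff ℝ (⊤ : ℕ∞) φ → HasCompactSupport φ → tsupport φ ⊆ K →
      ‖∫ z in U, (h z).det * wder m φ z‖ₑ ≤
        ENNReal.ofReal C ^ (1 / 2 : ℝ) * (∫⁻ z, ‖φ z‖ₑ ^ 2) ^ (1 / 2 : ℝ) := by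
  obtain ⟨L, hL, hLU, hKL, ε₀, hε₀, hmain⟩ := exists_lintegral_sq_circDiff_det_le r hU hK hKU m
  obtain ⟨B, hB⟩ := hbdd L hL hLU
  obtain ⟨B', C, hC⟩ := hmain B
  obtain ⟨hg, hC⟩ := hC h hh hB
  refine ⟨C, fun φ hφ hφc hφK => ?_⟩
  set g := L.indicator fun z => (h z).det with hgdef
  have hLt : volume L ≠ ⊤ := hL.measure_lt_top.ne
  have heq : ∫ z in U, (h z).det * wder m φ z = ∫ z, g z * wder m φ z := by
    rw [setIntegral_eq_of_subset_of_forall_sdiff_eq_zero hU.measurableSet hLU (fun z hz => ?_),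
      ← setIntegral_eq_integral_of_forall_compl_eq_zero (s := L) (f := fun z => g z * wder m φ z)
        (fun z hz => by rw [hg.eq_zero z hz, zero_mul])]
    · exact setIntegral_congr_fun hL.measurableSet fun z hz => by
        simp only [hgdef, Set.indicator_of_mem hz]
    · rw [wder_eq_zero_of_notMem_tsupport m
        (fun h' => hz.2 (mem_of_mem_nhds (hKL z (hφK h')))), mul_zero]
  rw [heq]
  refine le_of_tendsto ((tendsto_integral_mul_circDiff hLt hg m hφ hφc).enorm) ?_
  filter_upwards [Ioo_mem_nhdsGT hε₀] with ε hε
  rw [integral_mul_circDiff hLt hg m ε hφ.continuous hφc, enorm_neg,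
    ← setIntegral_eq_integral_of_forall_compl_eq_zero (s := K)
      (fun z hz => by rw [image_eq_zero_of_notMem_tsupport (fun h' => hz (hφK h')), mul_zero])]
  refine (enorm_integral_le_lintegral_enorm _).trans
    ((lintegral_enorm_mul_le (measurable_circDiff m ε hg.measurable).aemeasurable
      hφ.continuous.aemeasurable).trans ?_)
  gcongr
  · exact hC ε hε.1 hε.2.le
  · exact Measure.restrict_le_self

theorem exists_lintegral_sq_wder_det_le {n : ℕ} (r : ℕ) {U K : Set (Cn n)}
    (hU : IsOpen U) (hK : IsCompact K) (hKU : K ⊆ U) (m : Fin n) :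
    ∃ L : Set (Cn n), IsCompact L ∧ L ⊆ U ∧
      ∀ B : ℝ, ∃ C : ℝ, ∀ h : Cn n → Matrix (Fin r) (Fin r) ℂ, WeakSemiNegOn U h →
        (∀ a, ∀ z ∈ L, sqNorm (h z) (polVec a) ≤ B) →
        DifferentiableOn ℝ (fun z => (h z).det) U →
        ∫⁻ z in K, ‖wder m (fun w => (h w).det) z‖ₑ ^ 2 ≤ ENNReal.ofReal C := by
  obtain ⟨L, hL, hLU, hKL, ε₀, hε₀, hmain⟩ := exists_lintegral_sq_circDiff_det_le r hU hK hKU m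
  refine ⟨L, hL, hLU, fun B => ?_⟩
  obtain ⟨B', C, hC⟩ := hmain B
  refine ⟨C, fun h hh hB hd => ?_⟩
  obtain ⟨hg, hC⟩ := hC h hh hB
  set g := L.indicator fun z => (h z).det with hgdef
  obtain ⟨ε, -, hε, hε0⟩ := exists_seq_strictAnti_tendsto' hε₀
  have hε' : Tendsto ε atTop (𝓝[>] 0) :=
    tendsto_nhdsWithin_iff.2 ⟨hε0, Eventually.of_forall fun k => (hε k).1⟩
  have hlim : ∀ z ∈ K, Tendsto (fun k => ‖circDiff m (ε k) g z‖ₑ ^ 2) atTop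
      (𝓝 (‖wder m (fun w => (h w).det) z‖ₑ ^ 2)) := by
    intro z hz
    have hev : (fun w => (h w).det) =ᶠ[𝓝 z] g := by
      filter_upwards [hKL z hz] with w hw
      rw [hgdef, Set.indicator_of_mem hw]
    have hdz : DifferentiableAt ℝ g z :=
      ((hd z (hKU hz)).differentiableAt (hU.mem_nhds (hKU hz))).congr_of_eventuallyEq hev.symm
    rw [wder_congr m hev]
    exact ((ENNReal.continuous_pow 2).tendsto _).comp (((tendsto_circDiff m hdz
      (Eventually.of_forall fun e => hg.integrable_circleShift m e z)).comp hε').enorm)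
  calc ∫⁻ z in K, ‖wder m (fun w => (h w).det) z‖ₑ ^ 2
      = ∫⁻ z in K, liminf (fun k => ‖circDiff m (ε k) g z‖ₑ ^ 2) atTop :=
        setLIntegral_congr_fun hK.measurableSet fun z hz => ((hlim z hz).liminf_eq).symm
    _ ≤ liminf (fun k => ∫⁻ z in K, ‖circDiff m (ε k) g z‖ₑ ^ 2) atTop :=
        lintegral_liminf_le fun k => (measurable_circDiff m (ε k) hg.measurable).enorm.pow_const 2
    _ ≤ liminf (fun _ : ℕ => ENNReal.ofReal C) atTop :=
        liminf_le_liminf (Eventually.of_forall fun k => hC _ (hε k).1 (hε k).2.le)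
    _ = ENNReal.ofReal C := liminf_const _

theorem PshOn.congr {n : ℕ} {U : Set (Cn n)} {f g : Cn n → EReal} (hf : PshOn f U)
    (h : ∀ z ∈ U, f z = g z) : PshOn g U := by
  refine ⟨fun z hz y hy => ?_, fun z hz v ρ hρ hU F hF hF' hle => ?_⟩
  · have hy' : f z < y := by rwa [h z hz]
    filter_upwards [hf.1 z hz y hy', self_mem_nhdsWithin] with w hw hwU
    show g w < y
    rwa [← h w hwU]
  · rw [← h z hz]
    exact hf.2 z hz v ρ hρ hU F hF hF' fun w hw => by
      rw [h _ (hU w hw.le)]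
      exact hle w hw

theorem GriffithsSemiNegOn.pshOnR_const {n r : ℕ} {U : Set (Cn n)} (hU : IsOpen U)
    {h : Cn n → Matrix (Fin r) (Fin r) ℂ} (hh : GriffithsSemiNegOn U h) (v : Fin r → ℂ) :
    PshOnR (fun z => sqNorm (h z) v) U :=
  hh U hU subset_rfl (fun _ => v) fun _ => differentiableOn_const _

theorem SmoothMetricOn.contDiffOn_det {n r : ℕ} {U : Set (Cn n)}
    {h : Cn n → Matrix (Fin r) (Fin r) ℂ} (hh : SmoothMetricOn U h) :
    ContDiffOn ℝ (⊤ : ℕ∞) (fun z => (h z).det) U := by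
  simp only [Matrix.det_apply]
  exact ContDiffOn.sum fun σ _ => (contDiffOn_prod fun i _ => hh.1 (σ i) i).const_smul _

theorem SmoothMetricOn.weakSemiNegOn_indicator {n r : ℕ} {U : Set (Cn n)} (hU : IsOpen U)
    {h : Cn n → Matrix (Fin r) (Fin r) ℂ} (hs : SmoothMetricOn U h)
    (hh : GriffithsSemiNegOn U h) : WeakSemiNegOn U (U.indicator h) where
  measurable a b := by
    classical
    have h1 : (fun z => U.indicator h z a b) = U.indicator fun z => h z a b := by
      ext z
      by_cases hz : z ∈ U <;> simp [hz]
    rw [h1, ← Set.piecewise_eq_indicator]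
    exact (hs.1 a b).continuousOn.measurable_piecewise continuousOn_const hU.measurableSet
  posSemidef z hz := by
    rw [Set.indicator_of_mem hz]
    exact (hs.2 z hz).posSemidef
  psh v := (hh.pshOnR_const hU v).congr fun z hz => by
    simp only [Set.indicator_of_mem hz]

theorem PshOnR.bddAbove_of_isCompact {n : ℕ} {U L : Set (Cn n)} {f : Cn n → ℝ} (hf : PshOnR f U)
    (hL : IsCompact L) (hLU : L ⊆ U) : ∃ B, ∀ z ∈ L, f z ≤ B := by
  have h1 : UpperSemicontinuousOn f L := fun z hz y hy => by
    filter_upwards [nhdsWithin_mono z hLU (hf.1 z (hLU hz) y (EReal.coe_lt_coe_iff.2 hy))]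
      with w hw using EReal.coe_lt_coe_iff.1 hw
  obtain ⟨B, hB⟩ := h1.bddAbove_of_isCompact hL
  exact ⟨B, fun z hz => hB ⟨z, hz, rfl⟩⟩

theorem WeakSemiNegOn.exists_sqNorm_polVec_le {n r : ℕ} {U L : Set (Cn n)}
    {h : Cn n → Matrix (Fin r) (Fin r) ℂ} (hh : WeakSemiNegOn U h) (hL : IsCompact L)
    (hLU : L ⊆ U) : ∃ B, ∀ a, ∀ z ∈ L, sqNorm (h z) (polVec a) ≤ B := by
  choose B hB using fun a : Fin r × Fin r × Fin 3 =>
    (hh.psh (polVec a)).bddAbove_of_isCompact hL hLU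
  refine ⟨∑ a, |B a|, fun a z hz => (hB a z hz).trans ((le_abs_self _).trans ?_)⟩
  exact Finset.single_le_sum (f := fun a => |B a|) (fun _ _ => abs_nonneg _) (Finset.mem_univ a)

theorem DecreasingApproxOn.sqNorm_le {n r : ℕ} {U : Set (Cn n)}
    {h : Cn n → Matrix (Fin r) (Fin r) ℂ} {hs : ℕ → Cn n → Matrix (Fin r) (Fin r) ℂ}
    (hhs : DecreasingApproxOn U h hs) {z : Cn n} (hz : z ∈ U) (v : Fin r → ℂ) (ν : ℕ) :
    sqNorm (hs ν z) v ≤ sqNorm (hs 0 z) v := by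
  refine antitone_nat_of_succ_le (f := fun ν => sqNorm (hs ν z) v) (fun ν => ?_) (Nat.zero_le ν)
  have := sqNorm_nonneg (hhs.2.2.1 z hz ν) v
  rw [sqNorm_sub] at this
  linarith

theorem DecreasingApproxOn.exists_sqNorm_polVec_le {n r : ℕ} {U L : Set (Cn n)} (hU : IsOpen U)
    {h : Cn n → Matrix (Fin r) (Fin r) ℂ} {hs : ℕ → Cn n → Matrix (Fin r) (Fin r) ℂ}
    (hhs : DecreasingApproxOn U h hs) (hL : IsCompact L) (hLU : L ⊆ U) :
    ∃ B, ∀ ν a, ∀ z ∈ L, sqNorm (hs ν z) (polVec a) ≤ B := by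
  obtain ⟨B, hB⟩ := ((hhs.1 0).weakSemiNegOn_indicator hU (hhs.2.1 0)).exists_sqNorm_polVec_le
    hL hLU
  refine ⟨B, fun ν a z hz => (hhs.sqNorm_le (hLU hz) _ ν).trans ?_⟩
  have := hB a z hz
  rwa [Set.indicator_of_mem (hLU hz)] at this

/-- Locally uniform `L²` bounds for `∂(det h_ν)`. -/
theorem DecreasingApproxOn.exists_lintegral_sq_wder_det_le {n r : ℕ} {U K : Set (Cn n)}
    (hU : IsOpen U) {h : Cn n → Matrix (Fin r) (Fin r) ℂ}
    {hs : ℕ → Cn n → Matrix (Fin r) (Fin r) ℂ} (hhs : DecreasingApproxOn U h hs)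
    (hK : IsCompact K) (hKU : K ⊆ U) (m : Fin n) :
    ∃ C : ℝ, ∀ ν, ∫⁻ z in K, ‖wder m (fun w => (hs ν w).det) z‖ₑ ^ 2 ≤ ENNReal.ofReal C := by
  obtain ⟨L, hL, hLU, hmain⟩ := _root_.exists_lintegral_sq_wder_det_le r hU hK hKU m
  obtain ⟨B, hB⟩ := hhs.exists_sqNorm_polVec_le hU hL hLU
  obtain ⟨C, hC⟩ := hmain B
  refine ⟨C, fun ν => ?_⟩
  have heq : Set.EqOn (fun w => (U.indicator (hs ν) w).det) (fun w => (hs ν w).det) U :=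
    fun z hz => by simp only [Set.indicator_of_mem hz]
  refine le_trans (le_of_eq ?_) (hC (U.indicator (hs ν))
    ((hhs.1 ν).weakSemiNegOn_indicator hU (hhs.2.1 ν)) (fun a z hz => ?_) ?_)
  · refine setLIntegral_congr_fun hK.measurableSet fun z hz => ?_
    rw [wder_congr m (heq.eventuallyEq_of_mem (hU.mem_nhds (hKU hz)))]
  · rw [Set.indicator_of_mem (hLU hz)]
    exact hB ν a z hz
  · exact ((hhs.1 ν).contDiffOn_det.differentiableOn (by simp)).congr heq

theorem exists_inner_eq_of_norm_le {V H : Type*} [AddCommGroup V] [Module ℂ V]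
    [NormedAddCommGroup H] [InnerProductSpace ℂ H] [CompleteSpace H] (ι : V →ₗ[ℂ] H)
    (T : V →ₗ[ℂ] ℂ) {C : ℝ} (hT : ∀ v, ‖T v‖ ≤ C * ‖ι v‖) :
    ∃ w : H, ∀ v, T v = inner ℂ w (ι v) := by
  have hker : LinearMap.ker ι ≤ LinearMap.ker T := fun v hv => by
    have h := hT v
    rw [LinearMap.mem_ker.1 hv, norm_zero, mul_zero, norm_le_zero_iff] at h
    exact h
  let S : LinearMap.range ι →ₗ[ℂ] ℂ :=
    (LinearMap.ker ι).liftQ T hker ∘ₗ ι.quotKerEquivRange.symm.toLinearMap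
  have hS : ∀ v, S ⟨ι v, LinearMap.mem_range_self ι v⟩ = T v := fun v => by
    have h1 : ι.quotKerEquivRange.symm ⟨ι v, LinearMap.mem_range_self ι v⟩ =
        Submodule.Quotient.mk v := by
      rw [LinearEquiv.symm_apply_eq]
      rfl
    simp only [S, LinearMap.comp_apply, LinearEquiv.coe_coe, h1]
    exact Submodule.liftQ_apply _ _ _
  obtain ⟨G, hG, -⟩ := exists_extension_norm_eq (LinearMap.range ι) (S.mkContinuous C (by
    rintro ⟨_, v, rfl⟩
    rw [hS]
    exact hT v))
  refine ⟨(InnerProductSpace.toDual ℂ H).symm G, fun v => ?_⟩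
  rw [InnerProductSpace.toDual_symm_apply, ← hS v, hG ⟨ι v, LinearMap.mem_range_self ι v⟩]
  rfl

theorem wder_add {n : ℕ} (m : Fin n) {f g : Cn n → ℂ} {z : Cn n} (hf : DifferentiableAt ℝ f z)
    (hg : DifferentiableAt ℝ g z) : wder m (f + g) z = wder m f z + wder m g z := by
  simp only [wder, fderiv_add hf hg, _root_.add_apply]
  ring

theorem wder_const_smul {n : ℕ} (m : Fin n) (c : ℂ) {f : Cn n → ℂ} {z : Cn n}
    (hf : DifferentiableAt ℝ f z) : wder m (c • f) z = c * wder m f z := by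
  simp only [wder, fderiv_const_smul hf c, _root_.smul_apply, smul_eq_mul]
  ring

/-- Smooth functions vanishing outside `K`. -/
def testFunctions {n : ℕ} (K : Set (Cn n)) : Submodule ℂ (Cn n → ℂ) where
  carrier := {φ | ContDiff ℝ (⊤ : ℕ∞) φ ∧ ∀ z ∉ K, φ z = 0}
  add_mem' := fun ha hb => ⟨ha.1.add hb.1, fun z hz => by simp [ha.2 z hz, hb.2 z hz]⟩
  zero_mem' := ⟨contDiff_const, fun _ _ => rfl⟩
  smul_mem' := fun c _ ha => ⟨ha.1.const_smul c, fun z hz => by simp [ha.2 z hz]⟩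

theorem tsupport_subset_of_mem_testFunctions {n : ℕ} {K : Set (Cn n)} (hK : IsClosed K)
    {φ : Cn n → ℂ} (hφ : φ ∈ testFunctions K) : tsupport φ ⊆ K :=
  closure_minimal (fun z hz => by
    by_contra h
    exact hz (hφ.2 z h)) hK

theorem mem_testFunctions_of_tsupport_subset {n : ℕ} {K : Set (Cn n)} {φ : Cn n → ℂ}
    (hφ : ContDiff ℝ (⊤ : ℕ∞) φ) (hφK : tsupport φ ⊆ K) : φ ∈ testFunctions K :=
  ⟨hφ, fun _ hz => image_eq_zero_of_notMem_tsupport fun h => hz (hφK h)⟩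

theorem hasCompactSupport_of_mem_testFunctions {n : ℕ} {K : Set (Cn n)} (hK : IsCompact K)
    {φ : Cn n → ℂ} (hφ : φ ∈ testFunctions K) : HasCompactSupport φ :=
  HasCompactSupport.intro hK hφ.2

theorem integrable_mul_of_eq_zero {n : ℕ} {K : Set (Cn n)}
    {f ψ : Cn n → ℂ} (hf : IntegrableOn f K) (hψ : Continuous ψ) (hψc : HasCompactSupport ψ)
    (h0 : ∀ z ∉ K, ψ z = 0) : Integrable fun z => f z * ψ z := by
  obtain ⟨C, hC⟩ := hψ.bounded_above_of_compact_support hψc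
  refine (integrableOn_iff_integrable_of_support_subset (s := K) fun z hz => ?_).1
    (hf.mul_bdd (c := C) hψ.aestronglyMeasurable (Eventually.of_forall hC))
  by_contra h
  exact hz (by simp [h0 z h])

/-- Riesz representation of a distributional derivative that is bounded in `L²`. -/
theorem exists_eq_neg_integral_mul_of_enorm_le {n : ℕ} (U : Set (Cn n)) {K : Set (Cn n)}
    (hK : IsCompact K) (m : Fin n) {f : Cn n → ℂ} (hf : IntegrableOn f K) {C : ℝ}
    (hC : ∀ φ : Cn n → ℂ, ContDiff ℝ (⊤ : ℕ∞) φ → HasCompactSupport φ → tsupport φ ⊆ K →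
      ‖∫ z in U, f z * wder m φ z‖ₑ ≤
        ENNReal.ofReal C ^ (1 / 2 : ℝ) * (∫⁻ z, ‖φ z‖ₑ ^ 2) ^ (1 / 2 : ℝ)) :
    ∃ D : Cn n → ℂ, Measurable D ∧ MemLp D 2 ∧
      ∀ φ : Cn n → ℂ, ContDiff ℝ (⊤ : ℕ∞) φ → tsupport φ ⊆ K →
        ∫ z in U, f z * wder m φ z = -∫ z, D z * φ z := by
  have hLp : ∀ φ ∈ testFunctions K, MemLp φ 2 := fun φ hφ =>
    hφ.1.continuous.memLp_of_hasCompactSupport (hasCompactSupport_of_mem_testFunctions hK hφ)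
  have hd : ∀ φ ∈ testFunctions K, Differentiable ℝ φ := fun φ hφ => hφ.1.differentiable (by simp)
  have hint : ∀ φ ∈ testFunctions K, IntegrableOn (fun z => f z * wder m φ z) U := fun φ hφ =>
    (integrable_mul_of_eq_zero hf (continuous_wder m hφ.1)
      (hasCompactSupport_wder m (hasCompactSupport_of_mem_testFunctions hK hφ)) fun z hz =>
        wder_eq_zero_of_notMem_tsupport m fun h =>
          hz (tsupport_subset_of_mem_testFunctions hK.isClosed hφ h)).integrableOn
  let ι : testFunctions K →ₗ[ℂ] Lp ℂ 2 (volume : Measure (Cn n)) :=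
    { toFun := fun φ => (hLp φ φ.2).toLp φ
      map_add' := fun φ ψ => MemLp.toLp_add (hLp φ φ.2) (hLp ψ ψ.2)
      map_smul' := fun c φ => MemLp.toLp_const_smul c (hLp φ φ.2) }
  let T : testFunctions K →ₗ[ℂ] ℂ :=
    { toFun := fun φ => ∫ z in U, f z * wder m φ z
      map_add' := fun φ ψ => by
        rw [← integral_add (hint φ φ.2) (hint ψ ψ.2)]
        refine integral_congr_ae (Eventually.of_forall fun z => ?_)
        simp only [Submodule.coe_add]
        rw [wder_add m (hd φ φ.2 z) (hd ψ ψ.2 z), mul_add]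
      map_smul' := fun c φ => by
        rw [RingHom.id_apply, smul_eq_mul, ← integral_const_mul]
        refine integral_congr_ae (Eventually.of_forall fun z => ?_)
        simp only [Submodule.coe_smul]
        rw [wder_const_smul m c (hd φ φ.2 z), mul_left_comm] }
  obtain ⟨w, hw⟩ := exists_inner_eq_of_norm_le ι T (C := (ENNReal.ofReal C ^ (1 / 2 : ℝ)).toReal)
    fun φ => by
      have h1 := hC φ φ.2.1 (hasCompactSupport_of_mem_testFunctions hK φ.2)
        (tsupport_subset_of_mem_testFunctions hK.isClosed φ.2)
      have h2 : (∫⁻ z, ‖(φ : Cn n → ℂ) z‖ₑ ^ 2) ^ (1 / 2 : ℝ) = eLpNorm (φ : Cn n → ℂ) 2 := by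
        rw [eLpNorm_eq_lintegral_rpow_enorm_toReal two_ne_zero ENNReal.ofNat_ne_top]
        simp
      rw [h2] at h1
      have h3 := ENNReal.toReal_mono (ENNReal.mul_ne_top (by simp) (hLp φ φ.2).eLpNorm_ne_top) h1
      rw [ENNReal.toReal_mul, toReal_enorm] at h3
      exact h3.trans (le_of_eq (by rw [← Lp.norm_toLp (φ : Cn n → ℂ) (hLp φ φ.2)]; rfl))
  refine ⟨fun z => -(starRingEnd ℂ) (w z), ?_, ?_, fun φ hφ hφK => ?_⟩
  · exact (Complex.continuous_conj.measurable.comp (Lp.stronglyMeasurable w).measurable).neg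
  · exact (Lp.memLp w).star.neg
  · have hφ' := mem_testFunctions_of_tsupport_subset hφ hφK
    have h1 := hw ⟨φ, hφ'⟩
    rw [L2.inner_def] at h1
    simp only [T, LinearMap.coe_mk, AddHom.coe_mk] at h1
    rw [h1, ← integral_neg]
    refine integral_congr_ae ?_
    filter_upwards [(hLp φ hφ').coeFn_toLp] with z hz
    simp only [ι, LinearMap.coe_mk, AddHom.coe_mk, RCLike.inner_apply]
    rw [hz]
    ring

theorem exists_compact_exhaustion {X : Type*} [TopologicalSpace X] [LocallyCompactSpace X]
    [SecondCountableTopology X] {U : Set X} (hU : IsOpen U) :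
    ∃ L : ℕ → Set X, (∀ j, IsCompact (L j)) ∧ (∀ j, L j ⊆ U) ∧ Monotone L ∧
      ∀ K, IsCompact K → K ⊆ U → ∃ j, K ⊆ interior (L j) := by
  have : LocallyCompactSpace U := hU.locallyCompactSpace
  let E := CompactExhaustion.choice U
  refine ⟨fun j => Subtype.val '' E j, fun j => (E.isCompact j).image continuous_subtype_val,
    fun j => Subtype.coe_image_subset U _, fun i j hij => Set.image_mono (E.subset hij),
    fun K hK hKU => ?_⟩
  have hK' : IsCompact (Subtype.val ⁻¹' K : Set U) := by
    rw [Subtype.isCompact_iff, Subtype.image_preimage_coe, Set.inter_eq_right.2 hKU]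
    exact hK
  obtain ⟨j, hj⟩ := E.exists_superset_of_isCompact hK'
  refine ⟨j + 1, fun z hz => ?_⟩
  have h1 : (⟨z, hKU hz⟩ : U) ∈ interior (E (j + 1)) := E.subset_interior_succ j (hj hz)
  exact interior_maximal (Set.image_mono interior_subset)
    (hU.isOpenMap_subtype_val _ isOpen_interior) ⟨_, h1, rfl⟩

theorem ae_eq_of_forall_integral_mul_eq {n : ℕ} {O : Set (Cn n)} (hO : IsOpen O)
    {D D' : Cn n → ℂ} (hD : MemLp D 2) (hD' : MemLp D' 2)
    (h : ∀ φ : Cn n → ℂ, ContDiff ℝ (⊤ : ℕ∞) φ → HasCompactSupport φ → tsupport φ ⊆ O →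
      ∫ z, D z * φ z = ∫ z, D' z * φ z) : ∀ᵐ z, z ∈ O → D z = D' z := by
  have hDD := (hD.sub hD').locallyIntegrable one_le_two
  have key := hO.ae_eq_zero_of_integral_contDiff_smul_eq_zero (hDD.locallyIntegrableOn O)
    fun g hg hgc hgO => by
      have hφ : ContDiff ℝ (⊤ : ℕ∞) fun z => (g z : ℂ) := Complex.ofRealCLM.contDiff.comp hg
      have hφc : HasCompactSupport fun z => (g z : ℂ) :=
        hgc.comp_left (g := Complex.ofReal) Complex.ofReal_zero
      have hφO : tsupport (fun z => (g z : ℂ)) ⊆ O :=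
        (closure_mono (Function.support_comp_subset (g := Complex.ofReal) Complex.ofReal_zero
          g)).trans hgO
      have hφL : MemLp (fun z => (g z : ℂ)) 2 := hφ.continuous.memLp_of_hasCompactSupport hφc
      have h1 := h _ hφ hφc hφO
      have h2 : ∫ z, g z • (D - D') z = (∫ z, D z * (g z : ℂ)) - ∫ z, D' z * (g z : ℂ) := by
        have hi := hD.integrable_mul hφL
        have hi' := hD'.integrable_mul hφL
        simp only [Pi.mul_def] at hi hi'
        rw [← integral_sub hi hi']
        refine integral_congr_ae (Eventually.of_forall fun z => ?_)
        simp only [Pi.sub_apply, Complex.real_smul]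
        ring
      rw [h2, h1, sub_self]
  filter_upwards [key] with z hz hzO
  exact sub_eq_zero.1 (hz hzO)

/-- A distributional derivative that is locally represented by `L²` functions is represented by a
measurable `L²_loc` function. -/
theorem exists_isWeakWirtDeriv_of_local {n : ℕ} {U : Set (Cn n)} (hU : IsOpen U) (m : Fin n)
    {f : Cn n → ℂ}
    (hloc : ∀ K, IsCompact K → K ⊆ U → ∃ D : Cn n → ℂ, Measurable D ∧ MemLp D 2 ∧
      ∀ φ : Cn n → ℂ, ContDiff ℝ (⊤ : ℕ∞) φ → tsupport φ ⊆ K →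
        ∫ z in U, f z * wder m φ z = -∫ z, D z * φ z) :
    ∃ D : Cn n → ℂ, Measurable D ∧ LocL2On U D ∧ IsWeakWirtDeriv U m f D := by
  obtain ⟨L, hL, hLU, hLmono, hLK⟩ := exists_compact_exhaustion hU
  choose Dj hDm hD2 hDφ using fun j => hloc (L j) (hL j) (hLU j)
  let O : ℕ → Set (Cn n) := fun j => interior (L j)
  have hO : ∀ j, IsOpen (O j) := fun j => isOpen_interior
  obtain ⟨D, hDmeas, hD⟩ := exists_measurable_piecewise (disjointed O)
    (fun j => MeasurableSet.disjointed (fun i => (hO i).measurableSet) j) Dj hDm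
    fun i j hij z hz => ((disjoint_disjointed O hij).le_bot hz).elim
  have hcompat : ∀ᵐ z, ∀ i j, i ≤ j → z ∈ O i → Dj i z = Dj j z := by
    refine ae_all_iff.2 fun i => ae_all_iff.2 fun j => ?_
    by_cases hij : i ≤ j
    · filter_upwards [ae_eq_of_forall_integral_mul_eq (hO i) (hD2 i) (hD2 j)
        fun φ hφ _ hφO => by
          have hi : tsupport φ ⊆ L i := hφO.trans interior_subset
          exact neg_injective
            ((hDφ i φ hφ hi).symm.trans (hDφ j φ hφ (hi.trans (hLmono hij))))] with z hz _
      exact hz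
    · exact Eventually.of_forall fun z h => (hij h).elim
  have hDO : ∀ j, ∀ᵐ z, z ∈ O j → D z = Dj j z := fun j => by
    filter_upwards [hcompat] with z hz hzO
    have h1 : z ∈ ⋃ i ∈ Finset.range (j + 1), disjointed O i := by
      rw [biUnion_range_succ_disjointed]
      exact le_partialSups O j hzO
    simp only [Set.mem_iUnion, Finset.mem_range, Nat.lt_succ_iff] at h1
    obtain ⟨i, hij, hzi⟩ := h1
    rw [hD i hzi]
    exact hz i j hij (disjointed_subset O i hzi)
  refine ⟨D, hDmeas, fun K hK hKU => ?_, fun φ hφ hφc hφU => ?_⟩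
  · obtain ⟨j, hj⟩ := hLK K hK hKU
    calc ∫⁻ z in K, (‖D z‖₊ : ℝ≥0∞) ^ 2 = ∫⁻ z in K, ‖Dj j z‖ₑ ^ 2 := by
          refine setLIntegral_congr_fun_ae hK.measurableSet ?_
          filter_upwards [hDO j] with z hz hzK
          rw [hz (hj hzK)]
          rfl
      _ ≤ ∫⁻ z, ‖Dj j z‖ₑ ^ 2 := setLIntegral_le_lintegral _ _
      _ < ⊤ := by
          simpa using lintegral_rpow_enorm_lt_top_of_eLpNorm_lt_top two_ne_zero
            ENNReal.ofNat_ne_top (hD2 j).2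
  · obtain ⟨j, hj⟩ := hLK _ hφc.isCompact hφU
    rw [hDφ j φ hφ (hj.trans interior_subset), ← setIntegral_eq_integral_of_forall_compl_eq_zero
      (s := U) fun z hz => by
        rw [image_eq_zero_of_notMem_tsupport fun h => hz (hφU h), mul_zero]]
    congr 1
    refine integral_congr_ae (ae_restrict_of_ae ?_)
    filter_upwards [hDO j] with z hz
    by_cases hzφ : z ∈ tsupport φ
    · simp only [hz (hj hzφ)]
    · simp only [image_eq_zero_of_notMem_tsupport hzφ, mul_zero]

theorem wder_mul {n : ℕ} (m : Fin n) {f g : Cn n → ℂ} {z : Cn n} (hf : DifferentiableAt ℝ f z)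
    (hg : DifferentiableAt ℝ g z) :
    wder m (fun w => f w * g w) z = wder m f z * g z + f z * wder m g z := by
  simp only [wder, fderiv_fun_mul hf hg, _root_.add_apply, _root_.smul_apply, smul_eq_mul]
  ring

theorem integral_wder_eq_zero {n : ℕ} (m : Fin n) {P : Cn n → ℂ} (hP : ContDiff ℝ (⊤ : ℕ∞) P)
    (hPc : HasCompactSupport P) : ∫ z, wder m P z = 0 := by
  have hi : ∀ v, Integrable fun z => fderiv ℝ P z v := fun v => by
    have hc : Continuous fun z => fderiv ℝ P z v :=
      (hP.continuous_fderiv (by simp)).clm_apply continuous_const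
    exact hc.integrable_of_hasCompactSupport
      (hPc.fderiv_apply ℝ v)
  have h0 : ∀ v, ∫ z, fderiv ℝ P z v = 0 := fun v => by
    have h := integral_mul_fderiv_eq_neg_fderiv_mul_of_integrable (𝕜 := ℂ) (μ := volume)
      (f := fun _ : Cn n => (1 : ℂ)) (g := P) (v := v) (by simp) (by simpa using hi v)
      (by simpa using hP.continuous.integrable_of_hasCompactSupport hPc)
      (fun _ _ => differentiableAt_const _) fun x _ => hP.differentiable (by simp) x
    simpa using h
  simp only [wder]
  rw [integral_const_mul, integral_sub (hi _) ((hi _).const_mul _), integral_const_mul, h0, h0]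
  simp

theorem contDiff_mul_of_tsupport_subset {n : ℕ} {U : Set (Cn n)} (hU : IsOpen U) {u φ : Cn n → ℂ}
    (hu : ContDiffOn ℝ (⊤ : ℕ∞) u U) (hφ : ContDiff ℝ (⊤ : ℕ∞) φ) (hφU : tsupport φ ⊆ U) :
    ContDiff ℝ (⊤ : ℕ∞) fun z => u z * φ z := by
  refine contDiff_iff_contDiffAt.2 fun z => ?_
  by_cases hz : z ∈ U
  · exact (hu.contDiffAt (hU.mem_nhds hz)).mul hφ.contDiffAt
  · refine (contDiffAt_const (c := (0 : ℂ))).congr_of_eventuallyEq ?_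
    filter_upwards [(isClosed_tsupport φ).isOpen_compl.mem_nhds fun h => hz (hφU h)] with w hw
    rw [image_eq_zero_of_notMem_tsupport hw, mul_zero]

theorem continuousOn_wder {n : ℕ} (m : Fin n) {U : Set (Cn n)} (hU : IsOpen U) {u : Cn n → ℂ}
    (hu : ContDiffOn ℝ (⊤ : ℕ∞) u U) : ContinuousOn (wder m u) U := by
  have h := hu.continuousOn_fderiv_of_isOpen hU (by simp)
  unfold wder
  fun_prop

theorem integral_wder_mul {n : ℕ} (m : Fin n) {U : Set (Cn n)} (hU : IsOpen U) {u φ : Cn n → ℂ}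
    (hu : ContDiffOn ℝ (⊤ : ℕ∞) u U) (hφ : ContDiff ℝ (⊤ : ℕ∞) φ) (hφc : HasCompactSupport φ)
    (hφU : tsupport φ ⊆ U) :
    ∫ z in U, wder m u z * φ z = -∫ z in U, u z * wder m φ z := by
  have hz : ∀ z, z ∉ tsupport φ → wder m φ z = 0 := fun z => wder_eq_zero_of_notMem_tsupport m
  have hi1 : IntegrableOn (fun z => wder m u z * φ z) U :=
    (integrable_mul_of_eq_zero (((continuousOn_wder m hU hu).mono hφU).integrableOn_compact
      hφc.isCompact) hφ.continuous hφc
      fun z => image_eq_zero_of_notMem_tsupport).integrableOn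
  have hi2 : IntegrableOn (fun z => u z * wder m φ z) U :=
    (integrable_mul_of_eq_zero ((hu.continuousOn.mono hφU).integrableOn_compact hφc.isCompact)
      (continuous_wder m hφ) (hasCompactSupport_wder m hφc) hz).integrableOn
  rw [eq_neg_iff_add_eq_zero, ← integral_add hi1 hi2,
    ← integral_wder_eq_zero m (contDiff_mul_of_tsupport_subset hU hu hφ hφU) hφc.mul_left,
    ← setIntegral_eq_integral_of_forall_compl_eq_zero (s := U)
      (f := wder m fun z => u z * φ z) fun z hz => ?_]
  · refine setIntegral_congr_fun hU.measurableSet fun z hz => ?_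
    rw [wder_mul m ((hu.differentiableOn (by simp) z hz).differentiableAt (hU.mem_nhds hz))
      (hφ.differentiable (by simp) z)]
  · exact wder_eq_zero_of_notMem_tsupport m fun h => hz (hφU (tsupport_mul_subset_right h))

theorem DecreasingApproxOn.tendsto_integral_wder_det_mul {n r : ℕ} {U : Set (Cn n)}
    (hU : IsOpen U) {h : Cn n → Matrix (Fin r) (Fin r) ℂ}
    {hs : ℕ → Cn n → Matrix (Fin r) (Fin r) ℂ} (hhs : DecreasingApproxOn U h hs) (m : Fin n)
    {φ : Cn n → ℂ} (hφ : ContDiff ℝ (⊤ : ℕ∞) φ) (hφc : HasCompactSupport φ)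
    (hφU : tsupport φ ⊆ U) :
    Tendsto (fun ν => ∫ z in U, wder m (fun w => (hs ν w).det) z * φ z) atTop
      (𝓝 (-∫ z in U, (h z).det * wder m φ z)) := by
  simp_rw [fun ν => integral_wder_mul m hU (hhs.1 ν).contDiffOn_det hφ hφc hφU]
  refine Tendsto.neg ?_
  obtain ⟨B, hB⟩ := hhs.exists_sqNorm_polVec_le hU hφc.isCompact hφU
  obtain ⟨C, hC0, hC⟩ := exists_norm_det_le r B
  have hw := continuous_wder m hφ
  refine tendsto_integral_of_dominated_convergence (fun z => C * ‖wder m φ z‖) (fun ν => ?_) ?_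
    (fun ν => ?_) ?_
  · exact ((hhs.1 ν).contDiffOn_det.continuousOn.mul hw.continuousOn).aestronglyMeasurable
      hU.measurableSet
  · exact ((hw.integrable_of_hasCompactSupport
      (hasCompactSupport_wder m hφc)).norm.const_mul C).integrableOn
  · refine Eventually.of_forall fun z => ?_
    by_cases hz : z ∈ tsupport φ
    · rw [norm_mul]
      exact mul_le_mul_of_nonneg_right (hC _ ((hhs.1 ν).2 z (hφU hz)).posSemidef
        fun a => hB ν a z hz) (norm_nonneg _)
    · simp [wder_eq_zero_of_notMem_tsupport m hz]
  · refine (ae_restrict_iff' hU.measurableSet).2 (Eventually.of_forall fun z hz => ?_)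
    refine Tendsto.mul_const _ ?_
    simp only [Matrix.det_apply]
    exact tendsto_finsetSum _ fun σ _ => (tendsto_finsetProd _ fun i _ =>
      hhs.2.2.2 z hz (σ i) i).const_smul _

theorem eLpNorm_two_eq {α : Type*} [MeasurableSpace α] {μ : Measure α} (f : α → ℂ) :
    eLpNorm f 2 μ = (∫⁻ x, ‖f x‖ₑ ^ 2 ∂μ) ^ (1 / 2 : ℝ) := by
  rw [eLpNorm_eq_lintegral_rpow_enorm_toReal two_ne_zero ENNReal.ofNat_ne_top]
  simp

theorem memLp_two_of_lintegral_lt_top {α : Type*} [MeasurableSpace α] {μ : Measure α} {f : α → ℂ}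
    (hf : AEMeasurable f μ) (h : ∫⁻ x, ‖f x‖ₑ ^ 2 ∂μ < ⊤) : MemLp f 2 μ :=
  ⟨hf.aestronglyMeasurable, by
    rw [eLpNorm_two_eq]
    exact ENNReal.rpow_lt_top_of_nonneg (by norm_num) h.ne⟩

theorem norm_integral_mul_le_of_eLpNorm_le {α : Type*} [MeasurableSpace α] {μ : Measure α}
    {f g : α → ℂ} (hf : AEMeasurable f μ) (hg : AEMeasurable g μ) {c δ : ℝ} (hc : 0 ≤ c)
    (hδ : 0 ≤ δ) (hfc : eLpNorm f 2 μ ≤ ENNReal.ofReal c)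
    (hgδ : eLpNorm g 2 μ ≤ ENNReal.ofReal δ) : ‖∫ x, f x * g x ∂μ‖ ≤ c * δ := by
  have h : ‖∫ x, f x * g x ∂μ‖ₑ ≤ ENNReal.ofReal (c * δ) := by
    rw [ENNReal.ofReal_mul hc]
    refine (enorm_integral_le_lintegral_enorm _).trans ((lintegral_enorm_mul_le hf hg).trans ?_)
    rw [← eLpNorm_two_eq, ← eLpNorm_two_eq]
    exact mul_le_mul' hfc hgδ
  rwa [← ofReal_norm, ENNReal.ofReal_le_ofReal_iff (by positivity)] at h

/-- Smooth functions supported in a fixed compact neighbourhood of `K` inside `U` approximate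
square-integrable functions vanishing outside `K`. -/
theorem exists_contDiff_eLpNorm_sub_le {n : ℕ} {χ : Cn n → ℝ} (hχ : ContDiff ℝ (⊤ : ℕ∞) χ)
    (hχ0 : ∀ z, 0 ≤ χ z) (hχ1 : ∀ z, χ z ≤ 1) {K : Set (Cn n)} (hχK : ∀ z ∈ K, χ z = 1)
    {ψ : Cn n → ℂ} (hψ : MemLp (K.indicator ψ) 2) {δ : ℝ} (hδ : 0 < δ) :
    ∃ φ : Cn n → ℂ, ContDiff ℝ (⊤ : ℕ∞) φ ∧ tsupport φ ⊆ tsupport χ ∧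
      eLpNorm (K.indicator ψ - φ) 2 ≤ ENNReal.ofReal δ := by
  obtain ⟨φ, -, hφ, hle⟩ := hψ.exist_eLpNorm_sub_le ENNReal.ofNat_ne_top
    (by norm_num) hδ
  refine ⟨fun z => χ z • φ z, hχ.smul hφ, tsupport_smul_subset_left χ φ,
    (eLpNorm_mono fun z => ?_).trans hle⟩
  have h : K.indicator ψ z = χ z • K.indicator ψ z := by
    by_cases hz : z ∈ K
    · rw [hχK z hz, one_smul]
    · simp [hz]
  rw [Pi.sub_apply, Pi.sub_apply, h, ← smul_sub, norm_smul, Real.norm_of_nonneg (hχ0 z), ← h]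
  exact mul_le_of_le_one_left (norm_nonneg _) (hχ1 z)

/-- A sequence bounded in `L²_loc` which converges when tested against smooth compactly supported
functions converges when tested against square-integrable functions on compact subsets. -/
theorem tendsto_setIntegral_mul_of_testFunctions {n : ℕ} {U : Set (Cn n)} (hU : IsOpen U)
    {F : ℕ → Cn n → ℂ} {D : Cn n → ℂ} (hF : ∀ ν, ContinuousOn (F ν) U)
    (hFb : ∀ L, IsCompact L → L ⊆ U → ∃ C : ℝ, ∀ ν, ∫⁻ z in L, ‖F ν z‖ₑ ^ 2 ≤ ENNReal.ofReal C)
    (hD : Measurable D) (hDL : LocL2On U D)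
    (hlim : ∀ φ : Cn n → ℂ, ContDiff ℝ (⊤ : ℕ∞) φ → HasCompactSupport φ → tsupport φ ⊆ U →
      Tendsto (fun ν => ∫ z in U, F ν z * φ z) atTop (𝓝 (∫ z in U, D z * φ z)))
    {K : Set (Cn n)} (hK : IsCompact K) (hKU : K ⊆ U) {ψ : Cn n → ℂ} (hψ : Measurable ψ)
    (hψ2 : ∫⁻ z in K, ‖ψ z‖ₑ ^ 2 < ⊤) :
    Tendsto (fun ν => ∫ z in K, F ν z * ψ z) atTop (𝓝 (∫ z in K, D z * ψ z)) := by
  obtain ⟨χ, hχ, hχc, hχU, hχ0, hχ1, hχK⟩ := exists_cutoff hK hU hKU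
  set L := tsupport χ
  have hL : IsCompact L := hχc.isCompact
  have hKL : K ⊆ L := fun z hz => subset_tsupport χ (by simp [hχK z hz])
  have hψ' : MemLp (K.indicator ψ) 2 :=
    (memLp_indicator_iff_restrict hK.measurableSet).2
      (memLp_two_of_lintegral_lt_top hψ.aemeasurable hψ2)
  obtain ⟨C, hC⟩ := hFb L hL hχU
  have hFm : ∀ ν, AEMeasurable (F ν) (volume.restrict L) := fun ν =>
    ((hF ν).mono hχU).aemeasurable hL.measurableSet
  have hFL : ∀ ν, MemLp (F ν) 2 (volume.restrict L) := fun ν =>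
    memLp_two_of_lintegral_lt_top (hFm ν) ((hC ν).trans_lt ENNReal.ofReal_lt_top)
  have hDL' : MemLp D 2 (volume.restrict L) :=
    memLp_two_of_lintegral_lt_top hD.aemeasurable (hDL L hL hχU)
  have hbF : ∀ ν, eLpNorm (F ν) 2 (volume.restrict L) ≤
      ENNReal.ofReal (ENNReal.ofReal C ^ (1 / 2 : ℝ)).toReal := fun ν => by
    rw [eLpNorm_two_eq, ENNReal.ofReal_toReal
      (ENNReal.rpow_ne_top_of_nonneg (by norm_num) ENNReal.ofReal_ne_top)]
    exact ENNReal.rpow_le_rpow (hC ν) (by norm_num)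
  have hbD : eLpNorm D 2 (volume.restrict L) ≤
      ENNReal.ofReal (eLpNorm D 2 (volume.restrict L)).toReal := by
    rw [ENNReal.ofReal_toReal hDL'.2.ne]
  set c₁ := (ENNReal.ofReal C ^ (1 / 2 : ℝ)).toReal
  set c₂ := (eLpNorm D 2 (volume.restrict L)).toReal
  have hc₁ : 0 ≤ c₁ := ENNReal.toReal_nonneg
  have hc₂ : 0 ≤ c₂ := ENNReal.toReal_nonneg
  have key : ∀ {G : Cn n → ℂ} {c : ℝ}, 0 ≤ c → MemLp G 2 (volume.restrict L) →
      eLpNorm G 2 (volume.restrict L) ≤ ENNReal.ofReal c → ∀ {φ : Cn n → ℂ} {δ : ℝ}, 0 ≤ δ →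
      ContDiff ℝ (⊤ : ℕ∞) φ → tsupport φ ⊆ L →
      eLpNorm (K.indicator ψ - φ) 2 ≤ ENNReal.ofReal δ →
      ‖(∫ z in K, G z * ψ z) - ∫ z in U, G z * φ z‖ ≤ c * δ := by
    intro G c hc hG hGc φ δ hδ hφ hφL hle
    have e1 : ∫ z in K, G z * ψ z = ∫ z in L, G z * K.indicator ψ z := by
      simp_rw [← Set.indicator_mul_right K G]
      rw [setIntegral_indicator hK.measurableSet, Set.inter_eq_right.2 hKL]
    have e2 : ∫ z in U, G z * φ z = ∫ z in L, G z * φ z := by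
      refine (setIntegral_eq_of_subset_of_forall_sdiff_eq_zero hU.measurableSet hχU
        fun z hz => ?_)
      rw [image_eq_zero_of_notMem_tsupport fun h => hz.2 (hφL h), mul_zero]
    have hφ2 : MemLp φ 2 (volume.restrict L) :=
      (hφ.continuous.memLp_of_hasCompactSupport
        (hL.of_isClosed_subset (isClosed_tsupport φ) hφL)).restrict L
    have hi₁ : IntegrableOn (fun z => G z * K.indicator ψ z) L := hG.integrable_mul (hψ'.restrict L)
    have hi₂ : IntegrableOn (fun z => G z * φ z) L := hG.integrable_mul hφ2
    rw [e1, e2, ← integral_sub hi₁ hi₂]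
    simp_rw [← mul_sub]
    exact norm_integral_mul_le_of_eLpNorm_le hG.1.aemeasurable
      ((hψ'.restrict L).1.sub hφ2.1).aemeasurable hc hδ hGc
      ((eLpNorm_mono_measure _ Measure.restrict_le_self).trans hle)
  rw [Metric.tendsto_atTop]
  intro ε hε
  set δ := ε / (2 * (c₁ + c₂ + 1))
  have hδ : 0 < δ := by positivity
  have hδε : (c₁ + c₂ + 1) * δ = ε / 2 := by
    simp only [δ]
    field_simp
  obtain ⟨φ, hφ, hφL, hle⟩ := exists_contDiff_eLpNorm_sub_le hχ hχ0 hχ1 hχK hψ' hδ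
  obtain ⟨N, hN⟩ := Metric.tendsto_atTop.1 (hlim φ hφ
    (hL.of_isClosed_subset (isClosed_tsupport φ) hφL) (hφL.trans hχU)) (ε / 2) (half_pos hε)
  refine ⟨N, fun ν hν => ?_⟩
  have h1 := key hc₁ (hFL ν) (hbF ν) hδ.le hφ hφL hle
  have h2 := key hc₂ hDL' hbD hδ.le hφ hφL hle
  have h3 := hN ν hν
  rw [dist_eq_norm] at h3 ⊢
  rw [norm_sub_rev] at h2
  calc _ = ‖((∫ z in K, F ν z * ψ z) - ∫ z in U, F ν z * φ z) +
        ((∫ z in U, F ν z * φ z) - ∫ z in U, D z * φ z) +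
        ((∫ z in U, D z * φ z) - ∫ z in K, D z * ψ z)‖ := by congr 1; ring
    _ ≤ _ := norm_add₃_le
    _ < ε := by nlinarith

theorem isOpen_polydisk {n : ℕ} (R : Fin n → ℝ) : IsOpen (Polydisk R) := by
  simp only [Polydisk, Set.ofPred_forall]
  exact isOpen_iInter_of_finite fun j =>
    isOpen_lt (continuous_apply j).norm continuous_const

/-- The determinant of a weakly semi-negative metric has square-integrable distributional
Wirtinger derivatives. -/
theorem WeakSemiNegOn.exists_isWeakWirtDeriv_det {n r : ℕ} {U : Set (Cn n)} (hU : IsOpen U)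
    {h : Cn n → Matrix (Fin r) (Fin r) ℂ} (hh : WeakSemiNegOn U h) (m : Fin n) :
    ∃ D : Cn n → ℂ, Measurable D ∧ LocL2On U D ∧
      IsWeakWirtDeriv U m (fun z => (h z).det) D := by
  refine exists_isWeakWirtDeriv_of_local hU m fun K hK hKU => ?_
  obtain ⟨B, hB⟩ := hh.exists_sqNorm_polVec_le hK hKU
  obtain ⟨C, -, hC⟩ := exists_norm_det_le r B
  have hint : IntegrableOn (fun z => (h z).det) K :=
    Measure.integrableOn_of_bounded (M := C) hK.measure_lt_top.ne
      hh.measurable_det.aestronglyMeasurable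
      ((ae_restrict_iff' hK.measurableSet).2 (Eventually.of_forall fun z hz =>
        hC _ (hh.posSemidef z (hKU hz)) fun a => hB a z hz))
  obtain ⟨C', hC'⟩ := hh.exists_enorm_integral_det_mul_wder_le hU hK hKU m
    fun _ hL hLU => hh.exists_sqNorm_polVec_le hL hLU
  exact exists_eq_neg_integral_mul_of_enorm_le U hK m hint hC'

/-- `∂(det h) ∈ L²_loc`; for any smooth Griffiths semi-negative decreasing
approximating sequence `h_ν`, `∂(det h_ν) ∈ L²_loc` uniformly in `ν` and
`∂(det h_ν) ⇀ ∂(det h)` weakly in `L²_loc`. -/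
theorem statement6 {n r : ℕ} (R : Fin n → ℝ) (hR : ∀ j, 0 < R j)
    (h : Cn n → Matrix (Fin r) (Fin r) ℂ)
    (hsing : IsSingularMetricOn (Polydisk R) h)
    (hneg : GriffithsSemiNegOn (Polydisk R) h) :
    ∀ m : Fin n, ∃ D : Cn n → ℂ,
      LocL2On (Polydisk R) D ∧
      IsWeakWirtDeriv (Polydisk R) m (fun z => (h z).det) D ∧
      ∀ hs : ℕ → Cn n → Matrix (Fin r) (Fin r) ℂ, DecreasingApproxOn (Polydisk R) h hs →
        (∀ K, IsCompact K → K ⊆ Polydisk R → ∃ C : ℝ≥0∞, C < ⊤ ∧ ∀ ν,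
          (∫⁻ z in K, (‖wder m (fun w => (hs ν w).det) z‖₊ : ℝ≥0∞) ^ 2) ≤ C) ∧
        (∀ K, IsCompact K → K ⊆ Polydisk R → ∀ ψ : Cn n → ℂ, Measurable ψ →
          (∫⁻ z in K, (‖ψ z‖₊ : ℝ≥0∞) ^ 2) < ⊤ →
          Filter.Tendsto (fun ν => ∫ z in K, wder m (fun w => (hs ν w).det) z * ψ z)
            Filter.atTop (nhds (∫ z in K, D z * ψ z))) := by
  intro m
  have hU := isOpen_polydisk R
  have hh : WeakSemiNegOn (Polydisk R) h := ⟨hsing.1, hsing.2.1, hneg.pshOnR_const hU⟩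
  obtain ⟨D, hD, hDL, hDw⟩ := hh.exists_isWeakWirtDeriv_det hU m
  refine ⟨D, hDL, hDw, fun hs hhs => ⟨fun K hK hKU => ?_, fun K hK hKU ψ hψ hψ2 => ?_⟩⟩
  · obtain ⟨C, hC⟩ := hhs.exists_lintegral_sq_wder_det_le hU hK hKU m
    exact ⟨ENNReal.ofReal C, ENNReal.ofReal_lt_top, hC⟩
  · refine tendsto_setIntegral_mul_of_testFunctions hU
      (fun ν => continuousOn_wder m hU (hhs.1 ν).contDiffOn_det)
      (fun L hL hLU => hhs.exists_lintegral_sq_wder_det_le hU hL hLU m) hD hDL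
      (fun φ hφ hφc hφU => ?_) hK hKU hψ hψ2
    simpa only [hDw φ hφ hφc hφU, neg_neg] using
      hhs.tendsto_integral_wder_det_mul hU m hφ hφc hφU
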